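/- arXiv:2012.09506 — 6 statements merged into one kernel-verified Lean document; each statement's English description precedes it below -/
import Mathlib

section
/- Let k be a real number with |k| > 2. Then for every complex number s, W₁(k;s) = |k|^s · ₂F₁(−s/2, (1−s)/2; 1; 4/k²), where |k|^s = exp(s·log|k|) and the hypergeometric series converges since |4/k²| < 1. -/
open MeasureTheory Real

/-- `t ^ s` for real `t ≥ 0` and complex `s`, with `0 ^ s := 0`. -/
noncomputable def cpow0 (t : ℝ) (s : ℂ) : ℂ :=
  if t = 0 then 0 else Complex.exp (s * Real.log t)

/-- Pochhammer symbol `(x)ₙ = x (x+1) ⋯ (x+n-1)` in `ℂ`. -/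
noncomputable def poch (x : ℂ) (n : ℕ) : ℂ := (ascPochhammer ℂ n).eval x

/-- The zeta Mahler function `W₁(k;s) = (2π)⁻¹ ∫₀^{2π} |k + 2 cos θ|^s dθ`. -/
noncomputable def W1 (k : ℝ) (s : ℂ) : ℂ :=
  ((2 * π : ℝ) : ℂ)⁻¹ * ∫ θ in (0:ℝ)..(2 * π), cpow0 |k + 2 * Real.cos θ| s

theorem choose_succ_mul (s : ℂ) (n : ℕ) :
    Ring.choose s (n + 1) * (n + 1) = Ring.choose s n * (s - n) := by
  have h (m : ℕ) := Ring.descPochhammer_eq_factorial_smul_choose s m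
  have h₁ := h (n + 1)
  rw [descPochhammer_succ_right, Polynomial.smeval_mul, h n] at h₁
  simp only [Polynomial.smeval_sub, Polynomial.smeval_X, Polynomial.smeval_natCast, pow_one,
    pow_zero, nsmul_eq_mul, mul_one, Nat.factorial_succ, Nat.cast_mul, Nat.cast_succ] at h₁
  have hn : (n.factorial : ℂ) ≠ 0 := by exact_mod_cast n.factorial_ne_zero
  apply mul_left_cancel₀ hn
  linear_combination -h₁

theorem poch_succ (x : ℂ) (n : ℕ) : poch x (n + 1) = poch x n * (x + n) :=
  ascPochhammer_succ_eval n x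

theorem integral_cos_pow_add_two (n : ℕ) :
    ∫ θ in (0:ℝ)..(2 * π), cos θ ^ (n + 2) =
      (n + 1) / (n + 2) * ∫ θ in (0:ℝ)..(2 * π), cos θ ^ n := by
  rw [integral_cos_pow]
  simp

theorem integral_cos_pow_odd_eq_zero (n : ℕ) :
    ∫ θ in (0:ℝ)..(2 * π), cos θ ^ (2 * n + 1) = 0 := by
  induction n with
  | zero => simp
  | succ n ih =>
    rw [show 2 * (n + 1) + 1 = 2 * n + 1 + 2 by ring, integral_cos_pow_add_two, ih, mul_zero]

theorem choose_mul_integral_cos_pow_even (s : ℂ) (n : ℕ) :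
    Ring.choose s (2 * n) * ((∫ θ in (0:ℝ)..(2 * π), cos θ ^ (2 * n) : ℝ) : ℂ) =
      ((2 * π : ℝ) : ℂ) *
        (poch (-s / 2) n * poch ((1 - s) / 2) n / (poch 1 n * (n.factorial : ℂ))) := by
  have hp (m : ℕ) : poch 1 m = (m.factorial : ℂ) := by
    simp [poch, ascPochhammer_eval_one]
  induction n with
  | zero => simp [poch]
  | succ n ih =>
    have h₁ := choose_succ_mul s (2 * n)
    have h₂ := choose_succ_mul s (2 * n + 1)
    rw [show 2 * (n + 1) = 2 * n + 2 by ring, integral_cos_pow_add_two]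
    simp only [hp, poch_succ, Nat.factorial_succ] at ih ⊢
    push_cast at h₁ h₂ ih ⊢
    have hf : (n.factorial : ℂ) ≠ 0 := by exact_mod_cast n.factorial_ne_zero
    have ha : (n : ℂ) + 1 ≠ 0 := by exact_mod_cast n.succ_ne_zero
    have hb : 2 * (n : ℂ) + 1 ≠ 0 := by exact_mod_cast (2 * n).succ_ne_zero
    have hc : 2 * (n : ℂ) + 2 ≠ 0 := by exact_mod_cast (2 * n + 1).succ_ne_zero
    rw [← eq_div_iff hb] at h₁
    rw [show 2 * (n : ℂ) + 1 + 1 = 2 * n + 2 by ring, ← eq_div_iff hc, h₁] at h₂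
    rw [h₂]
    generalize ((∫ θ in (0:ℝ)..(2 * π), cos θ ^ (2 * n) : ℝ) : ℂ) = J at ih ⊢
    calc _ = Ring.choose s (2 * n) * J * ((-s / 2 + n) * ((1 - s) / 2 + n) / (n + 1) ^ 2) := by
          field_simp
          ring
      _ = _ := by
          rw [ih]
          field_simp

theorem hasSum_one_add_cpow {x : ℂ} (hx : ‖x‖ < 1) (s : ℂ) :
    HasSum (fun n : ℕ ↦ Ring.choose s n * x ^ n) ((1 + x) ^ s) := by
  have h := (Complex.one_add_cpow_hasFPowerSeriesOnBall_zero (a := s)).hasSum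
    (y := x) (by
      rw [← ENNReal.ofReal_one, Metric.eball_ofReal]
      simpa using hx)
  simpa only [binomialSeries_apply, List.ofFn_const, List.prod_replicate, smul_eq_mul, zero_add]
    using h

theorem hasSum_integral_one_add_mul_cos_cpow {x : ℝ} (hx : |x| < 1) (s : ℂ) :
    HasSum (fun n : ℕ ↦ Ring.choose s n * (x : ℂ) ^ n *
        ((∫ θ in (0:ℝ)..(2 * π), cos θ ^ n : ℝ) : ℂ))
      (∫ θ in (0:ℝ)..(2 * π), (1 + ((x * cos θ : ℝ) : ℂ)) ^ s) := by
  have hs : Summable fun n : ℕ ↦ ‖Ring.choose s n * (x : ℂ) ^ n‖ :=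
    (hasSum_one_add_cpow (by simpa using hx) s).summable.norm
  have hcos (θ : ℝ) : ‖((x * cos θ : ℝ) : ℂ)‖ < 1 := by
    rw [Complex.norm_real, norm_eq_abs, abs_mul]
    exact (mul_le_of_le_one_right (abs_nonneg x) (abs_cos_le_one θ)).trans_lt hx
  have h := intervalIntegral.hasSum_integral_of_dominated_convergence (μ := volume)
    (a := 0) (b := 2 * π)
    (F := fun n θ ↦ Ring.choose s n * ((x * cos θ : ℝ) : ℂ) ^ n)
    (fun n _ ↦ ‖Ring.choose s n * (x : ℂ) ^ n‖)
    (fun n ↦ (by fun_prop : Continuous _).aestronglyMeasurable)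
    (fun n ↦ ae_of_all _ fun θ _ ↦ by
      rw [Complex.ofReal_mul, mul_pow, ← mul_assoc, norm_mul, norm_pow, Complex.norm_real]
      exact mul_le_of_le_one_right (norm_nonneg _)
        (pow_le_one₀ (norm_nonneg _) (abs_cos_le_one θ)))
    (ae_of_all _ fun _ _ ↦ hs) intervalIntegrable_const
    (ae_of_all _ fun θ _ ↦ hasSum_one_add_cpow (hcos θ) s)
  refine Eq.mp (congrArg (fun f ↦ HasSum f _) (funext fun n ↦ Eq.symm ?_)) h
  rw [← intervalIntegral.integral_ofReal, ← intervalIntegral.integral_const_mul]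
  congr 1 with θ
  push_cast
  ring

theorem cpow0_abs_add_two_mul_cos {k : ℝ} (hk : 2 < |k|) (s : ℂ) (θ : ℝ) :
    cpow0 |k + 2 * cos θ| s = cpow0 |k| s * (1 + ((2 / k * cos θ : ℝ) : ℂ)) ^ s := by
  have hk₀ : k ≠ 0 := by
    rintro rfl
    norm_num at hk
  have hx : |2 / k * cos θ| < 1 := by
    rw [abs_mul, abs_div, abs_two]
    exact (mul_le_of_le_one_right (by positivity) (abs_cos_le_one θ)).trans_lt
      ((div_lt_one (by positivity)).2 hk)
  have hpos : 0 < 1 + 2 / k * cos θ := by linarith [(abs_lt.1 hx).1]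
  have hfac : |k + 2 * cos θ| = |k| * (1 + 2 / k * cos θ) := by
    rw [show k + 2 * cos θ = k * (1 + 2 / k * cos θ) by field_simp, abs_mul, abs_of_pos hpos]
  have hk₁ : |k| ≠ 0 := abs_ne_zero.2 hk₀
  rw [hfac, cpow0, cpow0, if_neg hk₁, if_neg (mul_ne_zero hk₁ hpos.ne'),
    Real.log_mul hk₁ hpos.ne', ← Complex.ofReal_one, ← Complex.ofReal_add,
    Complex.cpow_def_of_ne_zero (by exact_mod_cast hpos.ne'), ← Complex.ofReal_log hpos.le,
    ← Complex.exp_add]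
  push_cast
  ring_nf

/-- For `|k| > 2` and any complex `s`,
`W₁(k;s) = |k|^s · ₂F₁(−s/2, (1−s)/2; 1; 4/k²)`. -/
theorem stmt0 (k : ℝ) (hk : 2 < |k|) (s : ℂ) :
    W1 k s = cpow0 |k| s *
      ∑' n : ℕ, poch (-s / 2) n * poch ((1 - s) / 2) n /
        (poch 1 n * (n.factorial : ℂ)) * (4 / (k : ℂ) ^ 2) ^ n := by
  have hx : |2 / k| < 1 := by
    rw [abs_div, abs_two]
    exact (div_lt_one (by linarith)).2 hk
  have h := hasSum_integral_one_add_mul_cos_cpow hx s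
  have hodd : ∀ n ∉ Set.range (fun m : ℕ ↦ 2 * m), Ring.choose s n * ((2 / k : ℝ) : ℂ) ^ n *
      ((∫ θ in (0:ℝ)..(2 * π), cos θ ^ n : ℝ) : ℂ) = 0 := by
    intro n hn
    obtain ⟨m, rfl | rfl⟩ := n.even_or_odd'
    · exact absurd ⟨m, rfl⟩ hn
    · simp [integral_cos_pow_odd_eq_zero]
  rw [← Function.Injective.hasSum_iff (mul_right_injective₀ two_ne_zero) hodd] at h
  have hpi : ((2 * π : ℝ) : ℂ) ≠ 0 := by exact_mod_cast two_pi_pos.ne'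
  simp only [W1, cpow0_abs_add_two_mul_cos hk, intervalIntegral.integral_const_mul]
  rw [mul_left_comm]
  congr 1
  refine ((h.mul_left _).tsum_eq.symm).trans (tsum_congr fun n ↦ ?_)
  simp only [Function.comp_apply]
  rw [mul_right_comm, choose_mul_integral_cos_pow_even, mul_assoc, inv_mul_cancel_left₀ hpi,
    pow_mul]
  push_cast
  ring
end

section
/- Let k be a real number with |k| = 2. Then for every complex number s with Re(s) > −1/2, W₁(k;s) = 2^s · Γ(1/2 + s) / (Γ(1 + s/2) · Γ((1+s)/2)), where Γ denotes the complex Gamma function. -/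
open MeasureTheory Real

/-- On `(0, π)`, `θ ↦ (1 + cos θ) / 2` has image `(0, 1)`. -/
theorem image_one_add_cos_div_two_Ioo :
    (fun θ : ℝ => (1 + Real.cos θ) / 2) '' Set.Ioo 0 π = Set.Ioo 0 1 := by
  ext x
  constructor
  · rintro ⟨θ, ⟨h0, h1⟩, rfl⟩
    have hs := Real.sin_pos_of_pos_of_lt_pi h0 h1
    have := Real.sin_sq_add_cos_sq θ
    constructor <;> dsimp only <;> nlinarith
  · rintro ⟨h0, h1⟩
    refine ⟨Real.arccos (2 * x - 1), ⟨Real.arccos_pos.2 (by linarith), ?_⟩, ?_⟩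
    · refine lt_of_le_of_ne (Real.arccos_le_pi _) fun h => ?_
      rw [Real.arccos_eq_pi] at h
      linarith
    · dsimp only
      rw [Real.cos_arccos (by linarith) (by linarith)]
      ring

theorem injOn_one_add_cos_div_two_Ioo :
    Set.InjOn (fun θ : ℝ => (1 + Real.cos θ) / 2) (Set.Ioo 0 π) := by
  intro a ha b hb h
  refine Real.injOn_cos ⟨ha.1.le, ha.2.le⟩ ⟨hb.1.le, hb.2.le⟩ ?_
  dsimp only at h
  linarith

theorem hasDerivWithinAt_one_add_cos_div_two (t : Set ℝ) (θ : ℝ) :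
    HasDerivWithinAt (fun θ : ℝ => (1 + Real.cos θ) / 2) (-Real.sin θ / 2) t θ :=
  (((Real.hasDerivAt_cos θ).const_add 1).div_const 2).hasDerivWithinAt

theorem cpow0_mul_of_pos {a x : ℝ} (ha : 0 < a) (hx : 0 < x) (s : ℂ) :
    cpow0 (a * x) s = (a : ℂ) ^ s * (x : ℂ) ^ s := by
  have h : (x : ℂ) ≠ 0 := by exact_mod_cast hx.ne'
  have h' : (a : ℂ) ≠ 0 := by exact_mod_cast ha.ne'
  rw [cpow0, if_neg (by positivity), Complex.cpow_def_of_ne_zero h,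
    Complex.cpow_def_of_ne_zero h', ← Complex.exp_add, Real.log_mul ha.ne' hx.ne',
    Complex.ofReal_add, Complex.ofReal_log ha.le, Complex.ofReal_log hx.le]
  ring_nf

/-- The integrand of the zeta Mahler function at `k = 2` is, up to the factor `4 ^ s`, the pullback
of a beta integrand under `θ ↦ (1 + cos θ) / 2`. -/
theorem abs_deriv_smul_beta_integrand (s : ℂ) {θ : ℝ} (hθ : θ ∈ Set.Ioo 0 π) :
    (4 : ℂ) ^ s * (|-Real.sin θ / 2| •
      ((((1 + Real.cos θ) / 2 : ℝ) : ℂ) ^ (s + 1 / 2 - 1) *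
        (1 - (((1 + Real.cos θ) / 2 : ℝ) : ℂ)) ^ ((1 / 2 : ℂ) - 1))) =
      cpow0 |2 + 2 * Real.cos θ| s := by
  have hx : (1 + Real.cos θ) / 2 ∈ Set.Ioo (0 : ℝ) 1 :=
    image_one_add_cos_div_two_Ioo ▸ Set.mem_image_of_mem _ hθ
  have hsin := Real.sin_pos_of_pos_of_lt_pi hθ.1 hθ.2
  have hsq := Real.sin_sq_add_cos_sq θ
  set x : ℝ := (1 + Real.cos θ) / 2 with hxdef
  have h0 : 0 < x := hx.1
  have h1 : 0 < 1 - x := sub_pos.2 hx.2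
  have habs : |2 + 2 * Real.cos θ| = 4 * x := by
    rw [abs_of_pos (by linarith)]
    linarith
  have hw : |-Real.sin θ / 2| = x ^ (1 / 2 : ℝ) * (1 - x) ^ (1 / 2 : ℝ) := by
    rw [← Real.mul_rpow h0.le h1.le, ← Real.sqrt_eq_rpow, ← Real.sqrt_sq_eq_abs]
    congr 1
    rw [hxdef]
    linarith
  have h0' : (x : ℂ) ≠ 0 := by exact_mod_cast h0.ne'
  have h1' : (1 - x : ℂ) ≠ 0 := by exact_mod_cast h1.ne'
  have e0 : (x : ℂ) ^ (1 / 2 : ℂ) * (x : ℂ) ^ (s + 1 / 2 - 1) = (x : ℂ) ^ s := by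
    rw [← Complex.cpow_add _ _ h0']
    ring_nf
  have e1 : (1 - x : ℂ) ^ (1 / 2 : ℂ) * (1 - x : ℂ) ^ ((1 / 2 : ℂ) - 1) = 1 := by
    rw [← Complex.cpow_add _ _ h1']
    norm_num
  rw [habs, cpow0_mul_of_pos four_pos h0, hw, Complex.real_smul, Complex.ofReal_mul,
    Complex.ofReal_cpow h0.le, Complex.ofReal_cpow h1.le]
  push_cast
  linear_combination (4 : ℂ) ^ s * (1 - x : ℂ) ^ (1 / 2 : ℂ) *
    (1 - x : ℂ) ^ ((1 / 2 : ℂ) - 1) * e0 + (4 : ℂ) ^ s * (x : ℂ) ^ s * e1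

theorem intervalIntegrable_cpow0_two_add_two_mul_cos {s : ℂ} (hs : -(1 / 2 : ℝ) < s.re) :
    IntervalIntegrable (fun θ : ℝ => cpow0 |2 + 2 * Real.cos θ| s) volume 0 π := by
  have hB := Complex.betaIntegral_convergent (u := s + 1 / 2) (v := 1 / 2)
    (by simp; linarith) (by norm_num)
  rw [intervalIntegrable_iff_integrableOn_Ioo_of_le zero_le_one,
    ← image_one_add_cos_div_two_Ioo,
    integrableOn_image_iff_integrableOn_abs_deriv_smul measurableSet_Ioo
      (fun θ _ => hasDerivWithinAt_one_add_cos_div_two _ θ) injOn_one_add_cos_div_two_Ioo] at hB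
  rw [intervalIntegrable_iff_integrableOn_Ioo_of_le pi_pos.le]
  exact IntegrableOn.congr_fun (hB.const_mul ((4 : ℂ) ^ s))
    (fun θ hθ => abs_deriv_smul_beta_integrand s hθ) measurableSet_Ioo

theorem integral_cpow0_two_add_two_mul_cos (s : ℂ) :
    ∫ θ in (0 : ℝ)..π, cpow0 |2 + 2 * Real.cos θ| s =
      (4 : ℂ) ^ s * Complex.betaIntegral (s + 1 / 2) (1 / 2) := by
  rw [Complex.betaIntegral, intervalIntegral.integral_of_le zero_le_one,
    intervalIntegral.integral_of_le pi_pos.le, integral_Ioc_eq_integral_Ioo,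
    integral_Ioc_eq_integral_Ioo, ← image_one_add_cos_div_two_Ioo,
    integral_image_eq_integral_abs_deriv_smul measurableSet_Ioo
      (fun θ _ => hasDerivWithinAt_one_add_cos_div_two _ θ) injOn_one_add_cos_div_two_Ioo,
    ← integral_const_mul]
  exact setIntegral_congr_fun measurableSet_Ioo
    fun θ hθ => (abs_deriv_smul_beta_integrand s hθ).symm

theorem W1_neg (k : ℝ) (s : ℂ) : W1 (-k) s = W1 k s := by
  have hper : Function.Periodic (fun θ : ℝ => cpow0 |k + 2 * Real.cos θ| s) (2 * π) := fun θ => by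
    simp only [Real.cos_add_two_pi]
  have h := hper.intervalIntegral_add_eq π 0
  have h' := intervalIntegral.integral_comp_add_right (a := 0) (b := 2 * π)
    (fun θ : ℝ => cpow0 |k + 2 * Real.cos θ| s) π
  rw [zero_add] at h h'
  rw [W1, W1, ← h, add_comm π, ← h']
  congr 2
  ext θ
  rw [Real.cos_add_pi, ← abs_neg]
  ring_nf

theorem W1_two {s : ℂ} (hs : -(1 / 2 : ℝ) < s.re) :
    W1 2 s = (π : ℂ)⁻¹ * ((4 : ℂ) ^ s * Complex.betaIntegral (s + 1 / 2) (1 / 2)) := by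
  have hI := intervalIntegrable_cpow0_two_add_two_mul_cos hs
  have hrefl : (fun θ : ℝ => cpow0 |2 + 2 * Real.cos (2 * π - θ)| s) =
      fun θ => cpow0 |2 + 2 * Real.cos θ| s := by
    simp only [Real.cos_two_pi_sub]
  have hI' : IntervalIntegrable (fun θ : ℝ => cpow0 |2 + 2 * Real.cos θ| s) volume π (2 * π) := by
    have h := (hI.comp_sub_left (2 * π)).symm
    rwa [hrefl, sub_zero, show 2 * π - π = π by ring] at h
  have hint := intervalIntegral.integral_comp_sub_left (a := 0) (b := π)
    (fun θ : ℝ => cpow0 |2 + 2 * Real.cos θ| s) (2 * π)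
  rw [hrefl, sub_zero, show 2 * π - π = π by ring] at hint
  rw [W1, ← intervalIntegral.integral_add_adjacent_intervals hI hI', ← hint,
    integral_cpow0_two_add_two_mul_cos]
  push_cast
  rw [mul_inv]
  ring

/-- For `|k| = 2` and `Re(s) > −1/2`,
`W₁(k;s) = 2^s · Γ(1/2 + s) / (Γ(1 + s/2) · Γ((1+s)/2))`. -/
theorem stmt1 (k : ℝ) (hk : |k| = 2) (s : ℂ) (hs : -(1/2 : ℝ) < s.re) :
    W1 k s = (2 : ℂ) ^ s * Complex.Gamma (1/2 + s) /
      (Complex.Gamma (1 + s/2) * Complex.Gamma ((1 + s)/2)) := by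
  have hW : W1 k s = W1 2 s := by
    rcases eq_or_eq_neg_of_abs_eq hk with rfl | rfl
    · rfl
    · exact W1_neg 2 s
  have hdup := Complex.Gamma_mul_Gamma_add_half ((1 + s) / 2)
  rw [show (1 + s) / 2 + 1 / 2 = 1 + s / 2 by ring, show 2 * ((1 + s) / 2) = 1 + s by ring,
    show 1 - (1 + s) = -s by ring, Complex.cpow_neg] at hdup
  have hG : Complex.Gamma (1 + s) ≠ 0 :=
    Complex.Gamma_ne_zero_of_re_pos (by simp; linarith)
  have h2 : (2 : ℂ) ^ s ≠ 0 := by simp [Complex.cpow_eq_zero_iff]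
  have h4 : (4 : ℂ) ^ s = 2 ^ s * 2 ^ s := by
    have h := Complex.mul_cpow_ofReal_nonneg (zero_le_two (α := ℝ)) (zero_le_two (α := ℝ)) s
    rw [Complex.ofReal_ofNat] at h
    rw [← h]
    norm_num
  have hhalf : Complex.Gamma (1 / 2) = (√π : ℝ) := by
    rw [← Real.Gamma_one_half_eq, ← Complex.Gamma_ofReal]
    norm_num
  have hpi : (π : ℂ) = (√π : ℝ) * (√π : ℝ) := by
    exact_mod_cast (Real.mul_self_sqrt pi_pos.le).symm
  have hsqrt : ((√π : ℝ) : ℂ) ≠ 0 := by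
    exact_mod_cast (Real.sqrt_pos.2 pi_pos).ne'
  rw [hW, W1_two hs, Complex.betaIntegral_eq_Gamma_mul_div _ _ (by simp; linarith) (by norm_num),
    mul_comm (Complex.Gamma (1 + s / 2)), hdup, hhalf, h4, hpi,
    show s + 1 / 2 + 1 / 2 = 1 + s by ring, add_comm s]
  field_simp
end

section
/- Let k be a real number with |k| > 2. Then for every complex number s, W₁(k; −s−1) = (k² − 4)^(−s−1/2) · W₁(k;s), where (k²−4)^(−s−1/2) := exp((−s−1/2)·log(k²−4)) (note k²−4 > 0). -/
open MeasureTheory Real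

theorem cpow0_of_pos {t : ℝ} (ht : 0 < t) (s : ℂ) :
    cpow0 t s = Complex.exp (s * Real.log t) := if_neg ht.ne'

theorem add_two_mul_cos_pos {a : ℝ} (ha : 2 < a) (θ : ℝ) : 0 < a + 2 * Real.cos θ := by
  linarith [Real.neg_one_le_cos θ]

theorem continuous_cpow0_add_two_mul_cos {a : ℝ} (ha : 2 < a) (s : ℂ) :
    Continuous fun θ : ℝ => cpow0 (a + 2 * Real.cos θ) s := by
  have h : Continuous fun θ : ℝ => Real.log (a + 2 * Real.cos θ) :=
    Continuous.log (by fun_prop) fun θ => (add_two_mul_cos_pos ha θ).ne'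
  simp_rw [cpow0_of_pos (add_two_mul_cos_pos ha _)]
  fun_prop

theorem W1_eq_half_period {a : ℝ} (ha : 2 < a) (s : ℂ) :
    W1 a s = (π : ℂ)⁻¹ * ∫ θ in (0:ℝ)..π, cpow0 (a + 2 * Real.cos θ) s := by
  have hc := continuous_cpow0_add_two_mul_cos ha s
  have habs (θ : ℝ) : |a + 2 * Real.cos θ| = a + 2 * Real.cos θ :=
    abs_of_pos (add_two_mul_cos_pos ha θ)
  have hsymm : ∫ θ in π..(2 * π), cpow0 (a + 2 * Real.cos θ) s =
      ∫ θ in (0:ℝ)..π, cpow0 (a + 2 * Real.cos θ) s := by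
    have h := intervalIntegral.integral_comp_sub_left
      (fun θ : ℝ => cpow0 (a + 2 * Real.cos θ) s) (2 * π) (a := 0) (b := π)
    simp only [Real.cos_two_pi_sub, sub_zero] at h
    rw [h]
    congr 1
    ring
  simp only [W1, habs]
  rw [← intervalIntegral.integral_add_adjacent_intervals
    (hc.intervalIntegrable 0 π) (hc.intervalIntegrable π (2 * π)), hsymm]
  push_cast
  field_simp
  ring

/-- The involution of `[0, π]` conjugating `a + 2 cos` to `(a ^ 2 - 4) / (a + 2 cos)`. -/
noncomputable def cosInversion (a φ : ℝ) : ℝ :=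
  Real.arccos (((a ^ 2 - 4) / (a + 2 * Real.cos φ) - a) / 2)

theorem one_sub_sq_cosInversion_arg {a : ℝ} (ha : 2 < a) (φ : ℝ) :
    1 - (((a ^ 2 - 4) / (a + 2 * Real.cos φ) - a) / 2) ^ 2 =
      (a ^ 2 - 4) * Real.sin φ ^ 2 / (a + 2 * Real.cos φ) ^ 2 := by
  have hy := (add_two_mul_cos_pos ha φ).ne'
  rw [Real.sin_sq]
  field_simp
  ring

theorem add_two_mul_cos_cosInversion {a : ℝ} (ha : 2 < a) (φ : ℝ) :
    a + 2 * Real.cos (cosInversion a φ) = (a ^ 2 - 4) / (a + 2 * Real.cos φ) := by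
  have hD : 0 < a ^ 2 - 4 := by nlinarith
  have h : (((a ^ 2 - 4) / (a + 2 * Real.cos φ) - a) / 2) ^ 2 ≤ 1 := by
    have h1 := one_sub_sq_cosInversion_arg ha φ
    have h2 : 0 ≤ (a ^ 2 - 4) * Real.sin φ ^ 2 / (a + 2 * Real.cos φ) ^ 2 := by positivity
    linarith
  obtain ⟨h1, h2⟩ := abs_le.1 ((sq_le_one_iff_abs_le_one _).1 h)
  rw [cosInversion, Real.cos_arccos h1 h2]
  ring

theorem continuous_cosInversion {a : ℝ} (ha : 2 < a) : Continuous (cosInversion a) := by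
  have h : Continuous fun φ : ℝ => (a ^ 2 - 4) / (a + 2 * Real.cos φ) :=
    Continuous.div (by fun_prop) (by fun_prop) fun φ => (add_two_mul_cos_pos ha φ).ne'
  exact Real.continuous_arccos.comp (by fun_prop)

theorem cosInversion_zero {a : ℝ} (ha : 2 < a) : cosInversion a 0 = π := by
  have h : ((a ^ 2 - 4) / (a + 2 * Real.cos 0) - a) / 2 = -1 := by
    have : a + 2 ≠ 0 := by linarith
    rw [Real.cos_zero]
    field_simp
    ring
  rw [cosInversion, h, Real.arccos_neg_one]

theorem cosInversion_pi {a : ℝ} (ha : 2 < a) : cosInversion a π = 0 := by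
  have h : ((a ^ 2 - 4) / (a + 2 * Real.cos π) - a) / 2 = 1 := by
    have : a - 2 ≠ 0 := by linarith
    rw [Real.cos_pi, mul_neg_one, ← sub_eq_add_neg]
    field_simp
    ring
  rw [cosInversion, h, Real.arccos_one]

theorem hasDerivAt_cosInversion {a φ : ℝ} (ha : 2 < a) (hφ : φ ∈ Set.Ioo 0 π) :
    HasDerivAt (cosInversion a) (-(√(a ^ 2 - 4) / (a + 2 * Real.cos φ))) φ := by
  have hD : 0 < a ^ 2 - 4 := by nlinarith
  have hy := add_two_mul_cos_pos ha φ
  have hs : 0 < Real.sin φ := Real.sin_pos_of_mem_Ioo hφ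
  have hu : 0 < 1 - (((a ^ 2 - 4) / (a + 2 * Real.cos φ) - a) / 2) ^ 2 := by
    rw [one_sub_sq_cosInversion_arg ha]
    positivity
  have hsqrt : √(1 - (((a ^ 2 - 4) / (a + 2 * Real.cos φ) - a) / 2) ^ 2) =
      √(a ^ 2 - 4) * Real.sin φ / (a + 2 * Real.cos φ) := by
    rw [one_sub_sq_cosInversion_arg ha, Real.sqrt_div' _ (sq_nonneg _), Real.sqrt_sq hy.le,
      Real.sqrt_mul hD.le, Real.sqrt_sq hs.le]
  have hu' : HasDerivAt (fun φ => ((a ^ 2 - 4) / (a + 2 * Real.cos φ) - a) / 2)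
      ((a ^ 2 - 4) * Real.sin φ / (a + 2 * Real.cos φ) ^ 2) φ := by
    have h := ((((hasDerivAt_const φ (a ^ 2 - 4)).div
      (((Real.hasDerivAt_cos φ).const_mul 2).const_add a) hy.ne').sub_const a).div_const 2)
    refine h.congr_deriv ?_
    field_simp
    ring
  have h := (Real.hasDerivAt_arccos (fun h => by rw [h] at hu; norm_num at hu)
    (fun h => by rw [h] at hu; norm_num at hu)).comp φ hu'
  refine h.congr_deriv ?_
  rw [hsqrt]
  have hq : 0 < √(a ^ 2 - 4) := Real.sqrt_pos.2 hD
  field_simp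
  rw [Real.sq_sqrt hD.le]

theorem sqrt_div_mul_cpow0_div {D y : ℝ} (hD : 0 < D) (hy : 0 < y) (s : ℂ) :
    ((√D / y : ℝ) : ℂ) * cpow0 (D / y) s = cpow0 D (s + 1 / 2) * cpow0 y (-s - 1) := by
  have h : √D / y = Real.exp (Real.log D / 2 - Real.log y) := by
    rw [Real.exp_sub, Real.exp_log hy, Real.exp_half, Real.exp_log hD]
  rw [h, cpow0_of_pos (div_pos hD hy), cpow0_of_pos hD, cpow0_of_pos hy,
    Real.log_div hD.ne' hy.ne', Complex.ofReal_exp, ← Complex.exp_add, ← Complex.exp_add]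
  congr 1
  push_cast
  ring

theorem integral_cpow0_add_two_mul_cos {a : ℝ} (ha : 2 < a) (s : ℂ) :
    ∫ θ in (0:ℝ)..π, cpow0 (a + 2 * Real.cos θ) s =
      cpow0 (a ^ 2 - 4) (s + 1 / 2) *
        ∫ θ in (0:ℝ)..π, cpow0 (a + 2 * Real.cos θ) (-s - 1) := by
  have hD : 0 < a ^ 2 - 4 := by nlinarith
  have hg := continuous_cpow0_add_two_mul_cos ha s
  have hf := continuous_cosInversion ha
  have hf' : Continuous fun φ : ℝ => -(√(a ^ 2 - 4) / (a + 2 * Real.cos φ)) :=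
    (Continuous.div (by fun_prop) (by fun_prop) fun φ => (add_two_mul_cos_pos ha φ).ne').neg
  have h := intervalIntegral.integral_deriv_smul_comp''' (a := 0) (b := π)
    (f := cosInversion a) (f' := fun φ => -(√(a ^ 2 - 4) / (a + 2 * Real.cos φ)))
    (g := fun θ => cpow0 (a + 2 * Real.cos θ) s) hf.continuousOn
    (fun φ hφ => by
      rw [min_eq_left Real.pi_pos.le, max_eq_right Real.pi_pos.le] at hφ
      exact (hasDerivAt_cosInversion ha hφ).hasDerivWithinAt)
    hg.continuousOn
    (hg.continuousOn.integrableOn_compact (isCompact_uIcc.image hf))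
    ((hf'.smul (hg.comp hf)).continuousOn.integrableOn_compact isCompact_uIcc)
  rw [cosInversion_zero ha, cosInversion_pi ha, intervalIntegral.integral_symm 0 π] at h
  rw [← neg_neg (∫ θ in (0:ℝ)..π, cpow0 (a + 2 * Real.cos θ) s), ← h,
    ← intervalIntegral.integral_neg, ← intervalIntegral.integral_const_mul]
  congr 1
  ext φ
  simp only [Function.comp_apply, add_two_mul_cos_cosInversion ha, neg_smul, neg_neg,
    Complex.real_smul]
  exact sqrt_div_mul_cpow0_div hD (add_two_mul_cos_pos ha φ) s

theorem W1_functional_equation_of_two_lt {a : ℝ} (ha : 2 < a) (s : ℂ) :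
    W1 a (-s - 1) = cpow0 (a ^ 2 - 4) (-s - 1 / 2) * W1 a s := by
  rw [W1_eq_half_period ha, W1_eq_half_period ha, integral_cpow0_add_two_mul_cos ha (-s - 1)]
  ring_nf

/-- Functional equation for `|k| > 2`:
`W₁(k; −s−1) = (k² − 4)^(−s−1/2) · W₁(k;s)`. -/
theorem stmt3 (k : ℝ) (hk : 2 < |k|) (s : ℂ) :
    W1 k (-s - 1) = cpow0 (k ^ 2 - 4) (-s - 1/2) * W1 k s := by
  rcases lt_abs.1 hk with h | h
  · exact W1_functional_equation_of_two_lt h s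
  · have := W1_functional_equation_of_two_lt h s
    rwa [W1_neg, W1_neg, neg_sq] at this
end

section
/- Let k be a real number with |k| < 2. Then for every complex number s with −1 < Re(s) < 0, W₁(k; −s−1) = cot(−πs/2) · (4 − k²)^(−s−1/2) · W₁(k;s), where cot denotes the complex cotangent and (4−k²)^(−s−1/2) := exp((−s−1/2)·log(4−k²)) (note 4−k² > 0, and both s and −s−1 lie in the strip of convergence Re > −1). -/
open MeasureTheory Real

open Filter Set Topology Asymptotics

theorem locallyIntegrable_abs_sub_rpow (c : ℝ) {p : ℝ} (hp : -1 < p) :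
    LocallyIntegrable (fun y : ℝ => |y - c| ^ p) := by
  have h0 : LocallyIntegrable (fun y : ℝ => |y| ^ p) := by
    refine locallyIntegrable_of_norm_le_rpow (C := 1) (α := -p) (by simp) ?_ ?_ ?_
    · simp; linarith
    · refine .of_forall fun y => ?_
      rw [Real.norm_of_nonneg (by positivity)]; simp
    · exact (Measurable.aestronglyMeasurable (by fun_prop))
  intro x
  obtain ⟨t, ht, hi⟩ := h0 (x - c)
  refine ⟨(fun y => y - c) ⁻¹' t, (continuous_sub_right c).continuousAt.preimage_mem_nhds ht, ?_⟩
  exact ((measurePreserving_sub_right volume c).integrableOn_comp_preimage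
    (MeasurableEquiv.subRight c).measurableEmbedding).2 hi

theorem isBigO_abs_sub_rpow_nhds {x c : ℝ} (h : x ≠ c) (p : ℝ) :
    (fun y : ℝ => |y - c| ^ p) =O[𝓝 x] (fun _ => (1 : ℝ)) := by
  refine Tendsto.isBigO_one (c := |x - c| ^ p) ℝ (ContinuousAt.tendsto ?_)
  refine ContinuousAt.rpow_const (by fun_prop) (Or.inl ?_)
  simpa [sub_eq_zero] using h

theorem isBigO_abs_sub_rpow_cocompact (c : ℝ) {p : ℝ} (hp : p ≤ 0) :
    (fun y : ℝ => |y - c| ^ p) =O[cocompact ℝ] (fun y => (1 + ‖y‖) ^ p) := by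
  refine IsBigO.of_bound ((1 / 4 : ℝ) ^ p) ?_
  have := tendsto_norm_cocompact_atTop (E := ℝ)
  filter_upwards [this.eventually_ge_atTop (1 + 2 * |c|)] with y hy
  rw [Real.norm_of_nonneg (by positivity), Real.norm_of_nonneg (by positivity),
    ← Real.mul_rpow (by norm_num) (by positivity)]
  rw [Real.norm_eq_abs] at *
  refine Real.rpow_le_rpow_of_nonpos (by positivity) ?_ hp
  have := abs_sub_abs_le_abs_sub y c
  linarith [abs_nonneg c]

/-- The weight `1 / √|(y - b)(y + a)|`, which is `0` at `y = b` and `y = -a`. -/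
noncomputable def wt (a b y : ℝ) : ℝ := |y - b| ^ (-1 / 2 : ℝ) * |y + a| ^ (-1 / 2 : ℝ)

theorem measurable_wt (a b : ℝ) : Measurable (wt a b) := by
  unfold wt; fun_prop

theorem integrable_abs_rpow_mul_wt {a b σ : ℝ} (ha : 0 < a) (hb : 0 < b) (h1 : -1 < σ)
    (h2 : σ < 0) : Integrable (fun y : ℝ => |y| ^ σ * wt a b y) := by
  have hm : Measurable (fun y : ℝ => |y| ^ σ * wt a b y) := by
    have := measurable_wt a b
    fun_prop
  have e : (fun y : ℝ => |y| ^ σ * wt a b y) =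
      fun y => |y - 0| ^ σ * (|y - b| ^ (-1 / 2 : ℝ) * |y - (-a)| ^ (-1 / 2 : ℝ)) := by
    funext y; simp [wt]
  refine LocallyIntegrable.integrable_of_isBigO_cocompact (g := fun y : ℝ => (1 + ‖y‖) ^ (-(1 - σ)))
    ?_ ?_ ?_
  · intro x
    have key : ∀ c p : ℝ, -1 < p → (fun y : ℝ => |y| ^ σ * wt a b y) =O[𝓝 x]
        (fun y => |y - c| ^ p) → IntegrableAtFilter (fun y : ℝ => |y| ^ σ * wt a b y) (𝓝 x) :=
      fun c p hp hO => hO.integrableAtFilter hm.stronglyMeasurable.stronglyMeasurableAtFilter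
        (locallyIntegrable_abs_sub_rpow c hp x)
    by_cases hxb : x = b
    · refine key b (-1 / 2) (by norm_num) ?_
      rw [e]
      have := ((isBigO_abs_sub_rpow_nhds (x := x) (c := 0) (by grind) σ).mul
        ((isBigO_refl (fun y : ℝ => |y - b| ^ (-1 / 2 : ℝ)) (𝓝 x)).mul
        (isBigO_abs_sub_rpow_nhds (x := x) (c := -a) (by grind) (-1 / 2))))
      simpa using this
    by_cases hxa : x = -a
    · refine key (-a) (-1 / 2) (by norm_num) ?_
      rw [e]
      have := ((isBigO_abs_sub_rpow_nhds (x := x) (c := 0) (by grind) σ).mul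
        ((isBigO_abs_sub_rpow_nhds (x := x) (c := b) (by grind) (-1 / 2)).mul
        (isBigO_refl (fun y : ℝ => |y - (-a)| ^ (-1 / 2 : ℝ)) (𝓝 x))))
      simpa using this
    · refine key 0 σ h1 ?_
      rw [e]
      have := ((isBigO_refl (fun y : ℝ => |y - 0| ^ σ) (𝓝 x)).mul
        ((isBigO_abs_sub_rpow_nhds (x := x) (c := b) (by grind) (-1 / 2)).mul
        (isBigO_abs_sub_rpow_nhds (x := x) (c := -a) (by grind) (-1 / 2))))
      simpa using this
  · rw [e]
    refine ((isBigO_abs_sub_rpow_cocompact 0 h2.le).mul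
      ((isBigO_abs_sub_rpow_cocompact b (by norm_num)).mul
        (isBigO_abs_sub_rpow_cocompact (-a) (by norm_num)))).congr_right fun y => ?_
    rw [← Real.rpow_add (by positivity), ← Real.rpow_add (by positivity)]
    congr 1; ring
  · exact (integrable_one_add_norm (by simp; linarith)).integrableAtFilter _

theorem ofReal_mul_I_cpow_of_pos {y : ℝ} (hy : 0 < y) (s : ℂ) :
    ((y : ℂ) * Complex.I) ^ s = cpow0 |y| s * Complex.exp (π * s / 2 * Complex.I) := by
  have h : (y : ℂ) * Complex.I ≠ 0 := by simp [hy.ne']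
  rw [Complex.cpow_def_of_ne_zero h, cpow0, if_neg (by positivity), ← Complex.exp_add]
  congr 1
  rw [Complex.log, Complex.arg_real_mul _ hy, Complex.arg_I]
  simp
  ring

theorem ofReal_mul_I_cpow_of_neg {y : ℝ} (hy : y < 0) (s : ℂ) :
    ((y : ℂ) * Complex.I) ^ s = cpow0 |y| s * Complex.exp (-(π * s / 2 * Complex.I)) := by
  have h : (y : ℂ) * Complex.I ≠ 0 := by simp [hy.ne]
  rw [Complex.cpow_def_of_ne_zero h, cpow0, if_neg (by simp [hy.ne]), ← Complex.exp_add]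
  congr 1
  have e : (y : ℂ) * Complex.I = ((-y : ℝ) : ℂ) * (-Complex.I) := by push_cast; ring
  rw [Complex.log, e, Complex.arg_real_mul _ (neg_pos.2 hy), Complex.arg_neg_I]
  simp
  ring

theorem cpow0_ofReal {t : ℝ} (ht : 0 < t) (p : ℝ) : cpow0 t p = ((t ^ p : ℝ) : ℂ) := by
  rw [cpow0, if_neg ht.ne', Real.rpow_def_of_pos ht]
  push_cast
  rw [mul_comm]

theorem norm_cpow0 {t : ℝ} (ht : 0 < t) (s : ℂ) : ‖cpow0 t s‖ = t ^ s.re := by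
  rw [cpow0, if_neg ht.ne', Real.rpow_def_of_pos ht, Complex.norm_exp]
  simp [mul_comm]

theorem measurable_cpow0 (s : ℂ) : Measurable fun t : ℝ => cpow0 t s := by
  unfold cpow0
  refine Measurable.ite (measurableSet_eq) (by fun_prop) (by fun_prop)

theorem norm_cpow_le_rpow {z w : ℂ} {r : ℝ} (hr : 0 < r) (hz : r ≤ ‖z‖) (hw : w.re ≤ 0) :
    ‖z ^ w‖ ≤ Real.exp (π * |w.im|) * r ^ w.re := by
  refine (Complex.norm_cpow_le z w).trans ?_
  rw [div_eq_mul_inv, ← Real.exp_neg, mul_comm]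
  gcongr ?_ * ?_
  · refine Real.exp_le_exp.2 ((neg_le_abs _).trans ?_)
    rw [abs_mul]
    gcongr
    exact Complex.abs_arg_le_pi z
  · exact Real.rpow_le_rpow_of_nonpos hr hz hw

/-- The integrand `z ^ s / √((z - b i)(z + a i))`, holomorphic on the right half-plane. -/
noncomputable def kern (a b : ℝ) (s z : ℂ) : ℂ :=
  z ^ s * ((z - b * Complex.I) ^ ((-1 / 2 : ℝ) : ℂ) * (z + a * Complex.I) ^ ((-1 / 2 : ℝ) : ℂ))

/-- The logarithmic derivative of `kern`. -/
noncomputable def kernLogDeriv (a b : ℝ) (s z : ℂ) : ℂ :=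
  s / z - 1 / 2 / (z - b * Complex.I) - 1 / 2 / (z + a * Complex.I)

theorem hasDerivAt_kern (a b : ℝ) (s : ℂ) {z : ℂ} (hz : 0 < z.re) :
    HasDerivAt (kern a b s) (kern a b s z * kernLogDeriv a b s z) z := by
  have h0 : z ∈ Complex.slitPlane := Or.inl hz
  have h1 : z - b * Complex.I ∈ Complex.slitPlane := Or.inl (by simpa using hz)
  have h2 : z + a * Complex.I ∈ Complex.slitPlane := Or.inl (by simpa using hz)
  have n0 := Complex.slitPlane_ne_zero h0
  have n1 := Complex.slitPlane_ne_zero h1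
  have n2 := Complex.slitPlane_ne_zero h2
  have d := ((hasDerivAt_id z).cpow_const (c := s) h0).mul
    ((((hasDerivAt_id z).sub_const (b * Complex.I)).cpow_const (c := ((-1 / 2 : ℝ) : ℂ)) h1).mul
    (((hasDerivAt_id z).add_const (a * Complex.I)).cpow_const (c := ((-1 / 2 : ℝ) : ℂ)) h2))
  refine d.congr_deriv ?_
  simp only [id, Pi.mul_apply, Complex.cpow_sub _ _ n0, Complex.cpow_sub _ _ n1,
    Complex.cpow_sub _ _ n2,
    Complex.cpow_one, kern, kernLogDeriv]
  field_simp
  push_cast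
  ring

theorem norm_kern_le {a b : ℝ} {s : ℂ} (hs : s.re < 0) {x y : ℝ} (h0 : y ≠ 0)
    (hb : y ≠ b) (ha : y ≠ -a) :
    ‖kern a b s (x + y * Complex.I)‖ ≤ Real.exp (π * |s.im|) * (|y| ^ s.re * wt a b y) := by
  have e1 : (x + y * Complex.I - b * Complex.I : ℂ) = x + (y - b : ℝ) * Complex.I := by
    push_cast; ring
  have e2 : (x + y * Complex.I + a * Complex.I : ℂ) = x + (y + a : ℝ) * Complex.I := by
    push_cast; ring
  have hle : ∀ t : ℝ, |t| ≤ ‖(x + t * Complex.I : ℂ)‖ := fun t => by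
    simpa using Complex.abs_im_le_norm (x + t * Complex.I : ℂ)
  rw [kern, norm_mul, norm_mul, Complex.norm_cpow_real, Complex.norm_cpow_real, e1, e2,
    wt, ← mul_assoc (Real.exp _)]
  have h1 : 0 < |y - b| := abs_pos.2 (sub_ne_zero.2 hb)
  have h2 : 0 < |y + a| := abs_pos.2 (by grind)
  refine mul_le_mul ?_ (mul_le_mul ?_ ?_ (by positivity) (by positivity)) (by positivity)
    (by positivity)
  · exact norm_cpow_le_rpow (abs_pos.2 h0) (hle y) hs.le
  · exact Real.rpow_le_rpow_of_nonpos h1 (hle _) (by norm_num)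
  · exact Real.rpow_le_rpow_of_nonpos h2 (hle _) (by norm_num)

theorem norm_kernLogDeriv_le (a b : ℝ) (s : ℂ) {x : ℝ} (hx : 0 < x) (y : ℝ) :
    ‖kernLogDeriv a b s (x + y * Complex.I)‖ ≤ (‖s‖ + 1) / x := by
  have hle : ∀ w c : ℂ, w.re = x → ‖c / w‖ ≤ ‖c‖ / x := fun w c hw => by
    rw [norm_div]
    gcongr
    simpa [hw, abs_of_pos hx] using Complex.abs_re_le_norm w
  calc _ ≤ ‖s‖ / x + ‖(1 / 2 : ℂ)‖ / x + ‖(1 / 2 : ℂ)‖ / x := by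
        refine (norm_sub_le _ _).trans (add_le_add ((norm_sub_le _ _).trans (add_le_add ?_ ?_)) ?_)
        all_goals exact hle _ _ (by simp)
    _ = _ := by norm_num; ring

theorem ae_ne_three (p q r : ℝ) : ∀ᵐ y : ℝ, y ≠ p ∧ y ≠ q ∧ y ≠ r := by
  filter_upwards [volume.ae_ne p, volume.ae_ne q, volume.ae_ne r] with y h1 h2 h3
  exact ⟨h1, h2, h3⟩

section Shift

variable {a b : ℝ} {s : ℂ}

theorem continuous_kern_line (a b : ℝ) (s : ℂ) {x : ℝ} (hx : 0 < x) :
    Continuous fun y : ℝ => kern a b s (x + y * Complex.I) := by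
  refine continuous_iff_continuousAt.2 fun y => ?_
  have := (hasDerivAt_kern a b s (z := x + y * Complex.I) (by simpa using hx)).continuousAt
  exact ContinuousAt.comp (f := fun y : ℝ => (x + y * Complex.I : ℂ)) this (by fun_prop)

theorem continuous_kernLogDeriv_line (a b : ℝ) (s : ℂ) {x : ℝ} (hx : 0 < x) :
    Continuous fun y : ℝ => kernLogDeriv a b s (x + y * Complex.I) := by
  have hne : ∀ w : ℂ, w.re = x → w ≠ 0 := fun w hw h => by simp [h] at hw; exact hx.ne hw
  unfold kernLogDeriv
  refine ((Continuous.div (by fun_prop) (by fun_prop) fun y => ?_).sub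
    (Continuous.div (by fun_prop) (by fun_prop) fun y => ?_)).sub
    (Continuous.div (by fun_prop) (by fun_prop) fun y => ?_)
  all_goals exact hne _ (by simp)

theorem integrable_kern_line (ha : 0 < a) (hb : 0 < b) (h1 : -1 < s.re) (h2 : s.re < 0)
    {x : ℝ} (hx : 0 < x) : Integrable fun y : ℝ => kern a b s (x + y * Complex.I) := by
  refine ((integrable_abs_rpow_mul_wt ha hb h1 h2).const_mul (Real.exp (π * |s.im|))).mono'
    (continuous_kern_line a b s hx).aestronglyMeasurable ?_
  filter_upwards [ae_ne_three 0 b (-a)] with y hy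
  exact norm_kern_le h2 hy.1 hy.2.1 hy.2.2

theorem hasDerivAt_integral_kern (ha : 0 < a) (hb : 0 < b) (h1 : -1 < s.re) (h2 : s.re < 0)
    {x : ℝ} (hx : 0 < x) :
    HasDerivAt (fun x : ℝ => ∫ y : ℝ, kern a b s (x + y * Complex.I)) 0 x := by
  have hint := (integrable_abs_rpow_mul_wt ha hb h1 h2).const_mul (Real.exp (π * |s.im|))
  have hd : ∀ x : ℝ, 0 < x → ∀ y : ℝ, HasDerivAt (kern a b s)
      (kern a b s (x + y * Complex.I) * kernLogDeriv a b s (x + y * Complex.I))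
      (x + y * Complex.I) := fun x hx y => hasDerivAt_kern a b s (by simpa using hx)
  obtain ⟨hi, hD⟩ := hasDerivAt_integral_of_dominated_loc_of_deriv_le
    (F := fun (x y : ℝ) => kern a b s (x + y * Complex.I))
    (F' := fun (x y : ℝ) => kern a b s (x + y * Complex.I) *
      kernLogDeriv a b s (x + y * Complex.I)) (μ := volume) (x₀ := x)
    (bound := fun y => Real.exp (π * |s.im|) * (|y| ^ s.re * wt a b y) * ((‖s‖ + 1) / (x / 2)))
    (Ioi_mem_nhds (half_lt_self hx))
    ((eventually_gt_nhds hx).mono fun t ht => (continuous_kern_line a b s ht).aestronglyMeasurable)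
    (integrable_kern_line ha hb h1 h2 hx)
    ((continuous_kern_line a b s hx).mul
      (continuous_kernLogDeriv_line a b s hx)).aestronglyMeasurable
    (by
      filter_upwards [ae_ne_three 0 b (-a)] with y hy t ht
      have ht : x / 2 < t := ht
      rw [norm_mul]
      refine mul_le_mul (norm_kern_le h2 hy.1 hy.2.1 hy.2.2)
        ((norm_kernLogDeriv_le a b s ((half_pos hx).trans ht) y).trans ?_) (norm_nonneg _)
        ((norm_nonneg _).trans (norm_kern_le (x := t) h2 hy.1 hy.2.1 hy.2.2))
      gcongr)
    (hint.mul_const _)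
    (by
      refine .of_forall fun y t ht => ?_
      have ht : x / 2 < t := ht
      have hline : HasDerivAt (fun x : ℝ => (x + y * Complex.I : ℂ)) 1 t :=
        (Complex.ofRealCLM.hasDerivAt (x := t)).add_const _
      simpa [Function.comp_def] using (hd t ((half_pos hx).trans ht) y).comp t hline)
  refine hD.congr_deriv ?_
  have hline : ∀ y : ℝ, HasDerivAt (fun y : ℝ => (x + y * Complex.I : ℂ)) Complex.I y := fun y => by
    simpa using ((Complex.ofRealCLM.hasDerivAt (x := y)).mul_const Complex.I).const_add (x : ℂ)
  have h0 := integral_eq_zero_of_hasDerivAt_of_integrable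
    (f := fun y : ℝ => kern a b s (x + y * Complex.I))
    (f' := fun y : ℝ => kern a b s (x + y * Complex.I) *
      kernLogDeriv a b s (x + y * Complex.I) * Complex.I)
    (fun y => by simpa [Function.comp_def] using (hd x hx y).comp y (hline y)) (hi.mul_const _)
    (integrable_kern_line ha hb h1 h2 hx)
  rw [integral_mul_const] at h0
  simpa using h0

theorem tendsto_integral_kern_atTop (ha : 0 < a) (hb : 0 < b) (h1 : -1 < s.re) (h2 : s.re < 0) :
    Tendsto (fun x : ℝ => ∫ y : ℝ, kern a b s (x + y * Complex.I)) atTop (𝓝 0) := by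
  have := tendsto_integral_filter_of_dominated_convergence (μ := volume) (l := atTop)
    (F := fun (x y : ℝ) => kern a b s (x + y * Complex.I)) (f := fun _ => 0)
    (fun y => Real.exp (π * |s.im|) * (|y| ^ s.re * wt a b y))
    ((eventually_gt_atTop 0).mono fun t ht => (continuous_kern_line a b s ht).aestronglyMeasurable)
    (.of_forall fun x => by
      filter_upwards [ae_ne_three 0 b (-a)] with y hy
      exact norm_kern_le h2 hy.1 hy.2.1 hy.2.2)
    ((integrable_abs_rpow_mul_wt ha hb h1 h2).const_mul _)
    (.of_forall fun y => by
      have hle : ∀ x : ℝ, 0 < x → ∀ w : ℂ, w.re = x → x ≤ ‖w‖ := fun x hx w hw => by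
        simpa [hw, abs_of_pos hx] using Complex.abs_re_le_norm w
      have hhalf : Tendsto (fun x : ℝ => x ^ (-1 / 2 : ℝ)) atTop (𝓝 0) := by
        simpa [neg_div] using tendsto_rpow_neg_atTop (y := 1 / 2) (by norm_num)
      have hlim : Tendsto (fun x : ℝ => Real.exp (π * |s.im|) * x ^ s.re *
          (x ^ (-1 / 2 : ℝ) * x ^ (-1 / 2 : ℝ))) atTop (𝓝 0) := by
        have := (((tendsto_rpow_neg_atTop (neg_pos.2 h2)).const_mul
          (Real.exp (π * |s.im|))).mul (hhalf.mul hhalf))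
        simpa using this
      refine squeeze_zero_norm' ?_ hlim
      filter_upwards [eventually_gt_atTop 0] with x hx
      rw [kern, norm_mul, norm_mul, Complex.norm_cpow_real, Complex.norm_cpow_real]
      refine mul_le_mul ?_ (mul_le_mul ?_ ?_ (by positivity) (by positivity)) (by positivity)
        (by positivity)
      · exact norm_cpow_le_rpow hx (hle x hx _ (by simp)) h2.le
      · exact Real.rpow_le_rpow_of_nonpos hx (hle x hx _ (by simp)) (by norm_num)
      · exact Real.rpow_le_rpow_of_nonpos hx (hle x hx _ (by simp)) (by norm_num))
  simpa using this

theorem tendsto_integral_kern_zero (ha : 0 < a) (hb : 0 < b) (h1 : -1 < s.re) (h2 : s.re < 0) :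
    Tendsto (fun x : ℝ => ∫ y : ℝ, kern a b s (x + y * Complex.I)) (𝓝[>] 0)
      (𝓝 (∫ y : ℝ, kern a b s (y * Complex.I))) := by
  refine tendsto_integral_filter_of_dominated_convergence
    (fun y => Real.exp (π * |s.im|) * (|y| ^ s.re * wt a b y))
    (eventually_mem_nhdsWithin.mono fun t ht =>
      (continuous_kern_line a b s ht).aestronglyMeasurable)
    (.of_forall fun x => by
      filter_upwards [ae_ne_three 0 b (-a)] with y hy
      exact norm_kern_le h2 hy.1 hy.2.1 hy.2.2)
    ((integrable_abs_rpow_mul_wt ha hb h1 h2).const_mul _) ?_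
  filter_upwards [ae_ne_three 0 b (-a)] with y hy
  refine Tendsto.mono_left ?_ nhdsWithin_le_nhds
  have hc : ContinuousAt (fun x : ℝ => kern a b s (x + y * Complex.I)) 0 := by
    unfold kern
    refine ContinuousAt.mul ?_ (ContinuousAt.mul ?_ ?_) <;>
      refine ContinuousAt.cpow (by fun_prop) continuousAt_const (Or.inr ?_)
    · simpa using hy.1
    · simpa [sub_eq_zero] using hy.2.1
    · have : y + a ≠ 0 := fun h => hy.2.2 (by linarith)
      simpa using this
  simpa using hc.tendsto

theorem integral_kern_boundary (ha : 0 < a) (hb : 0 < b) (h1 : -1 < s.re) (h2 : s.re < 0) :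
    ∫ y : ℝ, kern a b s (y * Complex.I) = 0 := by
  have hconst : ∀ x ∈ Ioi (0 : ℝ), ∫ y : ℝ, kern a b s (x + y * Complex.I) =
      ∫ y : ℝ, kern a b s ((1 : ℝ) + y * Complex.I) := fun x hx =>
    isOpen_Ioi.is_const_of_deriv_eq_zero isPreconnected_Ioi
      (fun t ht =>
        (hasDerivAt_integral_kern ha hb h1 h2 ht).differentiableAt.differentiableWithinAt)
      (fun t ht => (hasDerivAt_integral_kern ha hb h1 h2 ht).deriv) hx (mem_Ioi.2 one_pos)
  have hz : ∫ y : ℝ, kern a b s ((1 : ℝ) + y * Complex.I) = 0 :=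
    tendsto_nhds_unique (tendsto_const_nhds.congr'
      ((eventually_gt_atTop 0).mono fun x hx => (hconst x hx).symm))
      (tendsto_integral_kern_atTop ha hb h1 h2)
  refine tendsto_nhds_unique (tendsto_integral_kern_zero ha hb h1 h2) ?_
  refine tendsto_const_nhds.congr' (eventually_mem_nhdsWithin.mono fun x hx => ?_)
  simp only [hconst x hx, hz]

end Shift

theorem integrable_kern_boundary {a b : ℝ} {s : ℂ} (ha : 0 < a) (hb : 0 < b) (h1 : -1 < s.re)
    (h2 : s.re < 0) : Integrable fun y : ℝ => kern a b s (y * Complex.I) := by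
  refine ((integrable_abs_rpow_mul_wt ha hb h1 h2).const_mul (Real.exp (π * |s.im|))).mono'
    (Measurable.aestronglyMeasurable (by unfold kern; fun_prop)) ?_
  filter_upwards [ae_ne_three 0 b (-a)] with y hy
  simpa using norm_kern_le (x := 0) h2 hy.1 hy.2.1 hy.2.2

theorem ofReal_wt {a b y : ℝ} (hb : y ≠ b) (ha : y ≠ -a) :
    (wt a b y : ℂ) = cpow0 |y - b| ((-1 / 2 : ℝ) : ℂ) * cpow0 |y + a| ((-1 / 2 : ℝ) : ℂ) := by
  rw [wt, Complex.ofReal_mul, cpow0_ofReal (abs_pos.2 (sub_ne_zero.2 hb)),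
    cpow0_ofReal (abs_pos.2 (by grind))]

theorem kern_boundary_add {a b : ℝ} (s : ℂ) (ha : 0 < a) (hb : 0 < b) {y : ℝ} (h0 : y ≠ 0)
    (hyb : y ≠ b) (hya : y ≠ -a) :
    kern a b s (y * Complex.I) + kern b a s ((-y : ℝ) * Complex.I) =
      2 * (if y ∈ Ioo (-a) b then Complex.cos (π * s / 2) else Complex.sin (π * s / 2)) *
        (cpow0 |y| s * wt a b y) := by
  have e1 : (y * Complex.I - b * Complex.I : ℂ) = (y - b : ℝ) * Complex.I := by
    push_cast; ring
  have e2 : (y * Complex.I + a * Complex.I : ℂ) = (y + a : ℝ) * Complex.I := by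
    push_cast; ring
  have e3 : ((-y : ℝ) * Complex.I - a * Complex.I : ℂ) = (-(y + a) : ℝ) * Complex.I := by
    push_cast; ring
  have e4 : ((-y : ℝ) * Complex.I + b * Complex.I : ℂ) = (-(y - b) : ℝ) * Complex.I := by
    push_cast; ring
  have hp : Complex.exp (π * ((-1 / 2 : ℝ) : ℂ) / 2 * Complex.I) *
      Complex.exp (π * ((-1 / 2 : ℝ) : ℂ) / 2 * Complex.I) = -Complex.I := by
    rw [← Complex.exp_add, ← Complex.exp_neg_pi_div_two_mul_I]
    congr 1; push_cast; ring
  have hm : Complex.exp (-(π * ((-1 / 2 : ℝ) : ℂ) / 2 * Complex.I)) *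
      Complex.exp (-(π * ((-1 / 2 : ℝ) : ℂ) / 2 * Complex.I)) = Complex.I := by
    rw [← Complex.exp_add]
    refine Eq.trans ?_ Complex.exp_pi_div_two_mul_I
    congr 1; push_cast; ring
  have hpm : Complex.exp (π * ((-1 / 2 : ℝ) : ℂ) / 2 * Complex.I) *
      Complex.exp (-(π * ((-1 / 2 : ℝ) : ℂ) / 2 * Complex.I)) = 1 := by
    rw [← Complex.exp_add]; simp
  rw [kern, kern, e1, e2, e3, e4, ofReal_wt hyb hya, Complex.cos, Complex.sin, neg_mul]
  generalize ((-1 / 2 : ℝ) : ℂ) = p at *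
  rcases lt_or_gt_of_ne hya with h | h
  · have h' : y < b := by linarith
    have h'' : y < 0 := by linarith
    rw [if_neg (by simp; intro; linarith), ofReal_mul_I_cpow_of_neg h'',
      ofReal_mul_I_cpow_of_neg (sub_neg.2 h'), ofReal_mul_I_cpow_of_neg (by linarith : y + a < 0),
      ofReal_mul_I_cpow_of_pos (neg_pos.2 h''),
      ofReal_mul_I_cpow_of_pos (by linarith : 0 < -(y + a)),
      ofReal_mul_I_cpow_of_pos (by linarith : 0 < -(y - b))]
    simp only [abs_neg]
    linear_combination (cpow0 |y| s * cpow0 |y - b| p * cpow0 |y + a| p) *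
      (Complex.exp (-(π * s / 2 * Complex.I)) * hm + Complex.exp (π * s / 2 * Complex.I) * hp)
  rcases lt_or_gt_of_ne hyb with h' | h'
  · rw [if_pos ⟨h, h'⟩, ofReal_mul_I_cpow_of_neg (sub_neg.2 h'),
      ofReal_mul_I_cpow_of_pos (by linarith : 0 < y + a),
      ofReal_mul_I_cpow_of_neg (by linarith : -(y + a) < 0),
      ofReal_mul_I_cpow_of_pos (by linarith : 0 < -(y - b))]
    simp only [abs_neg]
    rcases lt_or_gt_of_ne h0 with h0 | h0
    · rw [ofReal_mul_I_cpow_of_neg h0, ofReal_mul_I_cpow_of_pos (neg_pos.2 h0), abs_neg]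
      linear_combination (cpow0 |y| s * cpow0 |y - b| p * cpow0 |y + a| p) *
        (Complex.exp (-(π * s / 2 * Complex.I)) + Complex.exp (π * s / 2 * Complex.I)) * hpm
    · rw [ofReal_mul_I_cpow_of_pos h0, ofReal_mul_I_cpow_of_neg (neg_lt_zero.2 h0), abs_neg]
      linear_combination (cpow0 |y| s * cpow0 |y - b| p * cpow0 |y + a| p) *
        (Complex.exp (-(π * s / 2 * Complex.I)) + Complex.exp (π * s / 2 * Complex.I)) * hpm
  · have h'' : 0 < y := by linarith
    rw [if_neg (by simp; intro; linarith), ofReal_mul_I_cpow_of_pos h'',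
      ofReal_mul_I_cpow_of_pos (sub_pos.2 h'),
      ofReal_mul_I_cpow_of_pos (by linarith : 0 < y + a),
      ofReal_mul_I_cpow_of_neg (neg_lt_zero.2 h''),
      ofReal_mul_I_cpow_of_neg (by linarith : -(y + a) < 0),
      ofReal_mul_I_cpow_of_neg (by linarith : -(y - b) < 0)]
    simp only [abs_neg]
    linear_combination (cpow0 |y| s * cpow0 |y - b| p * cpow0 |y + a| p) *
      (Complex.exp (-(π * s / 2 * Complex.I)) * hm + Complex.exp (π * s / 2 * Complex.I) * hp)

theorem cos_mul_integral_add_sin_mul_integral {a b : ℝ} {s : ℂ} (ha : 0 < a) (hb : 0 < b)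
    (h1 : -1 < s.re) (h2 : s.re < 0) :
    Complex.cos (π * s / 2) * (∫ y in Ioo (-a) b, cpow0 |y| s * wt a b y) +
      Complex.sin (π * s / 2) * (∫ y in Iio (-a) ∪ Ioi b, cpow0 |y| s * wt a b y) = 0 := by
  have hae : (fun y : ℝ => kern a b s (y * Complex.I) + kern b a s ((-y : ℝ) * Complex.I))
      =ᵐ[volume] fun y => 2 * (if y ∈ Ioo (-a) b then Complex.cos (π * s / 2)
        else Complex.sin (π * s / 2)) * (cpow0 |y| s * wt a b y) := by
    filter_upwards [ae_ne_three 0 b (-a)] with y hy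
    exact kern_boundary_add s ha hb hy.1 hy.2.1 hy.2.2
  have i1 := integrable_kern_boundary ha hb h1 h2
  have i2 := (integrable_kern_boundary hb ha h1 h2).comp_neg
  have z : ∫ y : ℝ, (kern a b s (y * Complex.I) + kern b a s ((-y : ℝ) * Complex.I)) = 0 := by
    rw [integral_add i1 i2, integral_kern_boundary ha hb h1 h2,
      integral_neg_eq_self (fun y : ℝ => kern b a s (y * Complex.I)),
      integral_kern_boundary hb ha h1 h2, add_zero]
  have hset : (Iio (-a) ∪ Ioi b : Set ℝ) =ᵐ[volume] (Ioo (-a) b)ᶜ := by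
    have : (Ioo (-a) b)ᶜ = Iic (-a) ∪ Ici b := by
      ext y; simp only [mem_compl_iff, mem_Ioo, mem_union, mem_Iic, mem_Ici]; grind
    exact (Iio_ae_eq_Iic.union Ioi_ae_eq_Ici).trans (EventuallyEq.of_eq this.symm)
  have hin : ∫ y in Ioo (-a) b, 2 * (if y ∈ Ioo (-a) b then Complex.cos (π * s / 2)
        else Complex.sin (π * s / 2)) * (cpow0 |y| s * wt a b y) =
      2 * Complex.cos (π * s / 2) * ∫ y in Ioo (-a) b, cpow0 |y| s * wt a b y := by
    rw [← integral_const_mul]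
    exact setIntegral_congr_fun measurableSet_Ioo fun y hy => by simp only [if_pos hy]
  have hout : ∫ y in (Ioo (-a) b)ᶜ, 2 * (if y ∈ Ioo (-a) b then Complex.cos (π * s / 2)
        else Complex.sin (π * s / 2)) * (cpow0 |y| s * wt a b y) =
      2 * Complex.sin (π * s / 2) * ∫ y in (Ioo (-a) b)ᶜ, cpow0 |y| s * wt a b y := by
    rw [← integral_const_mul]
    refine setIntegral_congr_fun measurableSet_Ioo.compl fun y hy => ?_
    have hy' : y ∉ Ioo (-a) b := (mem_compl_iff _ _).1 hy
    simp only [if_neg hy']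
  rw [integral_congr_ae hae, ← integral_add_compl measurableSet_Ioo ((i1.add i2).congr hae),
    hin, hout] at z
  have hcompl : ∫ y in Iio (-a) ∪ Ioi b, cpow0 |y| s * wt a b y =
      ∫ y in (Ioo (-a) b)ᶜ, cpow0 |y| s * wt a b y := setIntegral_congr_set hset
  rw [hcompl]
  linear_combination z / 2

theorem cpow0_mul {t u : ℝ} (ht : t ≠ 0) (hu : u ≠ 0) (s : ℂ) :
    cpow0 (t * u) s = cpow0 t s * cpow0 u s := by
  rw [cpow0, cpow0, cpow0, if_neg ht, if_neg hu, if_neg (mul_ne_zero ht hu), ← Complex.exp_add,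
    Real.log_mul ht hu]
  push_cast; ring_nf

theorem cpow0_inv {t : ℝ} (ht : t ≠ 0) (s : ℂ) : cpow0 t⁻¹ s = cpow0 t (-s) := by
  rw [cpow0, cpow0, if_neg ht, if_neg (inv_ne_zero ht), Real.log_inv]
  push_cast; ring_nf

theorem cpow0_add {t : ℝ} (ht : t ≠ 0) (s w : ℂ) : cpow0 t (s + w) = cpow0 t s * cpow0 t w := by
  rw [cpow0, cpow0, cpow0, if_neg ht, if_neg ht, if_neg ht, ← Complex.exp_add, add_mul]

theorem cpow0_one {t : ℝ} (ht : 0 < t) : cpow0 t 1 = t := by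
  simpa using cpow0_ofReal ht 1

theorem wt_neg_div {a b w : ℝ} (ha : 0 < a) (hb : 0 < b) (hw : w ≠ 0) :
    wt a b (-(a * b) / w) = (a * b) ^ (-1 / 2 : ℝ) * |w| * wt a b w := by
  have e1 : |-(a * b) / w - b| = b * |w + a| * |w|⁻¹ := by
    rw [show -(a * b) / w - b = -(b * (w + a)) * w⁻¹ by field_simp; ring, abs_mul, abs_neg, abs_mul,
      abs_of_pos hb, abs_inv]
  have e2 : |-(a * b) / w + a| = a * |w - b| * |w|⁻¹ := by
    rw [show -(a * b) / w + a = (a * (w - b)) * w⁻¹ by field_simp; ring, abs_mul, abs_mul,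
      abs_of_pos ha, abs_inv]
  have hw' : 0 < |w| := abs_pos.2 hw
  have e3 : (|w|⁻¹) ^ (-1 / 2 : ℝ) * (|w|⁻¹) ^ (-1 / 2 : ℝ) = |w| := by
    rw [← Real.rpow_add (by positivity)]; norm_num [Real.rpow_neg_one]
  rw [wt, wt, e1, e2, Real.mul_rpow (by positivity) (by positivity),
    Real.mul_rpow (by positivity) (by positivity), Real.mul_rpow (by positivity) (by positivity),
    Real.mul_rpow (by positivity) (by positivity), Real.mul_rpow ha.le hb.le]
  linear_combination (b ^ (-1 / 2 : ℝ) * |w + a| ^ (-1 / 2 : ℝ) *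
    (a ^ (-1 / 2 : ℝ) * |w - b| ^ (-1 / 2 : ℝ))) * e3

theorem integral_inversion {a b : ℝ} (s : ℂ) (ha : 0 < a) (hb : 0 < b) :
    ∫ y in Ioo (-a) b, cpow0 |y| (-s - 1) * wt a b y =
      cpow0 (a * b) (-s - 1 / 2) * ∫ y in Iio (-a) ∪ Ioi b, cpow0 |y| s * wt a b y := by
  have hab : 0 < a * b := mul_pos ha hb
  have hO : ∀ w ∈ Iio (-a) ∪ Ioi b, w ≠ 0 := by
    rintro w (h | h) rfl
    · simp only [mem_Iio] at h; linarith
    · simp only [mem_Ioi] at h; linarith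
  have himg : (fun w : ℝ => -(a * b) / w) '' (Iio (-a) ∪ Ioi b) = Ioo (-a) b \ {0} := by
    ext u
    simp only [mem_image, Set.mem_sdiff, mem_Ioo, mem_singleton_iff]
    constructor
    · rintro ⟨w, h, rfl⟩
      have hw := hO w h
      refine ⟨?_, div_ne_zero (neg_ne_zero.2 hab.ne') hw⟩
      rcases h with h | h
      · simp only [mem_Iio] at h
        have h0 : w < 0 := by linarith
        rw [lt_div_iff_of_neg h0, div_lt_iff_of_neg h0]
        constructor <;> nlinarith
      · simp only [mem_Ioi] at h
        have h0 : 0 < w := by linarith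
        rw [lt_div_iff₀ h0, div_lt_iff₀ h0]
        constructor <;> nlinarith
    · rintro ⟨⟨h, h'⟩, h0⟩
      refine ⟨-(a * b) / u, ?_, by field_simp⟩
      rcases lt_or_gt_of_ne h0 with h0 | h0
      · right
        simp only [mem_Ioi]
        rw [lt_div_iff_of_neg h0]; nlinarith
      · left
        simp only [mem_Iio]
        rw [div_lt_iff₀ h0]; nlinarith
  have hset : (Ioo (-a) b : Set ℝ) =ᵐ[volume] (Ioo (-a) b \ {0} : Set ℝ) :=
    (sdiff_null_ae_eq_self (by simp)).symm
  rw [setIntegral_congr_set hset, ← himg, integral_image_eq_integral_abs_deriv_smul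
    (f' := fun w => a * b / w ^ 2) (measurableSet_Iio.union measurableSet_Ioi),
    ← integral_const_mul]
  · refine setIntegral_congr_fun (measurableSet_Iio.union measurableSet_Ioi) fun w hw => ?_
    have hw' : 0 < |w| := abs_pos.2 (hO w hw)
    have e : |-(a * b) / w| = a * b * |w|⁻¹ := by
      rw [abs_div, abs_neg, abs_of_pos hab, div_eq_mul_inv]
    have c1 : cpow0 (a * b) (-s - 1 / 2) =
        cpow0 (a * b) (-s - 1) * (((a * b) ^ (-1 / 2 : ℝ) : ℝ) : ℂ) * ((a * b : ℝ) : ℂ) := by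
      rw [← cpow0_ofReal hab, ← cpow0_one hab, ← cpow0_add hab.ne', ← cpow0_add hab.ne']
      congr 1; push_cast; ring
    have c2 : cpow0 |w| (-(-s - 1)) = cpow0 |w| s * (|w| : ℝ) := by
      rw [← cpow0_one hw', ← cpow0_add hw'.ne']
      congr 1; ring
    rw [wt_neg_div ha hb (hO w hw), e, cpow0_mul hab.ne' (inv_ne_zero hw'.ne'), cpow0_inv hw'.ne',
      c1, c2, abs_of_nonneg (by positivity), ← sq_abs w, Complex.real_smul]
    have hwc : ((|w| : ℝ) : ℂ) ≠ 0 := by exact_mod_cast hw'.ne'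
    push_cast
    field_simp
  · intro w hw
    have := ((hasDerivAt_inv (hO w hw)).const_mul (-(a * b)))
    simp only [← div_eq_mul_inv] at this
    exact (this.congr_deriv (by field_simp)).hasDerivWithinAt
  · intro w hw w' hw' h
    have := hO w hw
    have := hO w' hw'
    simp only at h
    field_simp at h
    linarith

theorem image_add_two_mul_cos (k : ℝ) :
    (fun θ => k + 2 * Real.cos θ) '' Ioo 0 π = Ioo (k - 2) (k + 2) := by
  ext u
  constructor
  · rintro ⟨θ, ⟨h0, h1⟩, rfl⟩
    have hs := Real.sin_pos_of_pos_of_lt_pi h0 h1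
    have := Real.sin_sq_add_cos_sq θ
    constructor <;> simp only <;> nlinarith
  · rintro ⟨h0, h1⟩
    refine ⟨Real.arccos ((u - k) / 2), ⟨Real.arccos_pos.2 (by linarith), ?_⟩, ?_⟩
    · refine (Real.arccos_le_pi _).lt_of_ne fun h => ?_
      rw [Real.arccos_eq_pi] at h
      linarith
    · simp only
      rw [Real.cos_arccos (by linarith) (by linarith)]; ring

theorem W1_eq_integral_wt {k : ℝ} (hk : |k| < 2) {s : ℂ} (h1 : -1 < s.re) (h2 : s.re < 0) :
    W1 k s = (π : ℂ)⁻¹ * ∫ y in Ioo (-(2 - k)) (2 + k), cpow0 |y| s * wt (2 - k) (2 + k) y := by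
  obtain ⟨hk1, hk2⟩ := abs_lt.1 hk
  set a := 2 - k with ha
  set b := 2 + k with hb
  have hI : Integrable fun y : ℝ => cpow0 |y| s * wt a b y := by
    refine (integrable_abs_rpow_mul_wt (a := a) (b := b) (by linarith) (by linarith) h1 h2).mono'
      (Measurable.aestronglyMeasurable ?_) ?_
    · have := measurable_wt a b
      have := measurable_cpow0 s
      fun_prop
    · filter_upwards [volume.ae_ne 0] with y hy
      rw [norm_mul, norm_cpow0 (abs_pos.2 hy), Complex.norm_real, Real.norm_of_nonneg]
      unfold wt; positivity
  have hd : ∀ θ ∈ Ioo 0 π, HasDerivWithinAt (fun θ => k + 2 * Real.cos θ) (2 * -Real.sin θ)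
      (Ioo 0 π) θ := fun θ _ =>
    (((Real.hasDerivAt_cos θ).const_mul 2).const_add k).hasDerivWithinAt
  have hinj : InjOn (fun θ => k + 2 * Real.cos θ) (Ioo 0 π) := fun θ hθ θ' hθ' h =>
    Real.injOn_cos (Ioo_subset_Icc_self hθ) (Ioo_subset_Icc_self hθ') (by simp only at h; linarith)
  have himg : (fun θ => k + 2 * Real.cos θ) '' Ioo 0 π = Ioo (-a) b := by
    rw [image_add_two_mul_cos, ha, hb]; congr 1 <;> ring
  have hpt : EqOn (fun θ => |2 * -Real.sin θ| • (cpow0 |k + 2 * Real.cos θ| s *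
      (wt a b (k + 2 * Real.cos θ) : ℂ))) (fun θ => cpow0 |k + 2 * Real.cos θ| s) (Ioo 0 π) := by
    intro θ hθ
    have hs := Real.sin_pos_of_pos_of_lt_pi hθ.1 hθ.2
    have hw : |2 * -Real.sin θ| * wt a b (k + 2 * Real.cos θ) = 1 := by
      have e : |k + 2 * Real.cos θ - b| * |k + 2 * Real.cos θ + a| = (2 * Real.sin θ) ^ 2 := by
        rw [← abs_mul, ha, hb, ← abs_of_nonneg (sq_nonneg (2 * Real.sin θ)), ← abs_neg]
        congr 1
        linear_combination -4 * Real.sin_sq_add_cos_sq θ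
      rw [wt, ← Real.mul_rpow (abs_nonneg _) (abs_nonneg _), e, ← Real.rpow_natCast,
        ← Real.rpow_mul (by positivity), mul_neg, abs_neg, abs_of_pos (by positivity)]
      norm_num [Real.rpow_neg_one]
      field_simp
    simp only [Complex.real_smul]
    rw [mul_left_comm, ← Complex.ofReal_mul, hw, Complex.ofReal_one, mul_one]
  have hint : IntervalIntegrable (fun θ => cpow0 |k + 2 * Real.cos θ| s) volume 0 π := by
    rw [intervalIntegrable_iff_integrableOn_Ioo_of_le Real.pi_pos.le]
    refine IntegrableOn.congr_fun ?_ hpt measurableSet_Ioo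
    exact (integrableOn_image_iff_integrableOn_abs_deriv_smul measurableSet_Ioo hd hinj _).1
      hI.integrableOn
  have hsymm : ∀ θ, cpow0 |k + 2 * Real.cos (2 * π - θ)| s = cpow0 |k + 2 * Real.cos θ| s := by
    intro θ; rw [Real.cos_two_pi_sub]
  have hint' : IntervalIntegrable (fun θ => cpow0 |k + 2 * Real.cos θ| s) volume π (2 * π) := by
    have := (hint.comp_sub_left (2 * π)).symm
    simp only [hsymm] at this
    convert this using 1 <;> ring
  have heq : ∫ θ in π..(2 * π), cpow0 |k + 2 * Real.cos θ| s =
      ∫ θ in (0 : ℝ)..π, cpow0 |k + 2 * Real.cos θ| s := by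
    have := intervalIntegral.integral_comp_sub_left (a := π) (b := 2 * π)
      (fun θ => cpow0 |k + 2 * Real.cos θ| s) (2 * π)
    simp only [hsymm] at this
    rw [this]
    congr 1 <;> ring
  rw [W1, ← intervalIntegral.integral_add_adjacent_intervals hint hint', heq, ← himg,
    integral_image_eq_integral_abs_deriv_smul measurableSet_Ioo hd hinj,
    setIntegral_congr_fun measurableSet_Ioo hpt, intervalIntegral.integral_of_le Real.pi_pos.le,
    integral_Ioc_eq_integral_Ioo]
  push_cast
  field_simp
  ring

theorem sin_pi_mul_div_two_ne_zero {s : ℂ} (h1 : -1 < s.re) (h2 : s.re < 0) :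
    Complex.sin (π * s / 2) ≠ 0 := by
  intro h
  obtain ⟨n, hn⟩ := Complex.sin_eq_zero_iff.1 h
  have hs : s = ((2 * n : ℤ) : ℂ) := by
    have : (π : ℂ) ≠ 0 := by exact_mod_cast Real.pi_ne_zero
    have h' : (π : ℂ) * (s - 2 * n) = 0 := by linear_combination 2 * hn
    push_cast
    linear_combination (mul_eq_zero.1 h').resolve_left this
  rw [hs, Complex.intCast_re] at h1 h2
  have h1' : (-1 : ℤ) < 2 * n := by exact_mod_cast h1
  have h2' : 2 * n < (0 : ℤ) := by exact_mod_cast h2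
  omega

/-- Functional equation for `|k| < 2`, in the strip `−1 < Re(s) < 0`:
`W₁(k; −s−1) = cot(−πs/2) · (4 − k²)^(−s−1/2) · W₁(k;s)`. -/
theorem stmt4 (k : ℝ) (hk : |k| < 2) (s : ℂ) (hs1 : -1 < s.re) (hs2 : s.re < 0) :
    W1 k (-s - 1) =
      Complex.cot (-(Real.pi : ℂ) * s / 2) * cpow0 (4 - k ^ 2) (-s - 1/2) * W1 k s := by
  obtain ⟨hk1, hk2⟩ := abs_lt.1 hk
  have ha : 0 < 2 - k := by linarith
  have hb : 0 < 2 + k := by linarith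
  have hrel := cos_mul_integral_add_sin_mul_integral ha hb hs1 hs2
  have hsin := sin_pi_mul_div_two_ne_zero hs1 hs2
  rw [W1_eq_integral_wt hk (by simp; linarith) (by simp; linarith), W1_eq_integral_wt hk hs1 hs2,
    integral_inversion s ha hb, show (2 - k) * (2 + k) = 4 - k ^ 2 by ring,
    show -(π : ℂ) * s / 2 = -(π * s / 2) by ring, Complex.cot_eq_cos_div_sin, Complex.cos_neg,
    Complex.sin_neg]
  generalize cpow0 (4 - k ^ 2) (-s - 1 / 2) = c
  field_simp
  linear_combination c * hrel
end

section
/- Let r ≥ 1 be an integer and let k be a real number with |k| > 2^r. Then for every complex number s, W_r(k;s) = |k|^s · ₍r+1₎F_r(−s/2, (1−s)/2, 1/2, …, 1/2; 1, …, 1; 4^r/k²), i.e. W_r(k;s) = |k|^s · ∑_{n≥0} (−s/2)ₙ · ((1−s)/2)ₙ · ((1/2)ₙ)^(r−1) / (n!)^(r+1) · (4^r/k²)ⁿ, where the series converges since 4^r/k² < 1 and |k|^s := exp(s·log|k|). -/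
open MeasureTheory Real

/-- The zeta Mahler function
`W_r(k;s) = (2π)^{−r} ∫_{[0,2π]^r} |k + ∏ᵢ 2 cos θᵢ|^s dθ₁⋯dθ_r`. -/
noncomputable def Wr (r : ℕ) (k : ℝ) (s : ℂ) : ℂ :=
  ((2 * π : ℝ) : ℂ)⁻¹ ^ r *
    ∫ θ : Fin r → ℝ in Set.univ.pi fun _ => Set.Icc 0 (2 * π),
      cpow0 |k + ∏ i, 2 * Real.cos (θ i)| s

/-- The normalized moment `(2π)⁻¹ ∫₀^{2π} (2 cos x)ⁿ dx`. -/
noncomputable def cosMoment (n : ℕ) : ℝ :=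
  (2 * π)⁻¹ * ∫ x in Set.Icc 0 (2 * π), (2 * Real.cos x) ^ n

theorem cosMoment_zero : cosMoment 0 = 1 := by
  have h : 0 ≤ 2 * π := by positivity
  simp [cosMoment, h]
  field_simp

theorem cosMoment_one : cosMoment 1 = 0 := by
  have h : 0 ≤ 2 * π := by positivity
  simp [cosMoment, integral_Icc_eq_integral_Ioc, ← intervalIntegral.integral_of_le h]

theorem cosMoment_add_two (n : ℕ) :
    cosMoment (n + 2) = 4 * ((n + 1) / (n + 2)) * cosMoment n := by
  have h : 0 ≤ 2 * π := by positivity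
  simp only [cosMoment, integral_Icc_eq_integral_Ioc, ← intervalIntegral.integral_of_le h, mul_pow,
    intervalIntegral.integral_const_mul, integral_cos_pow]
  simp
  ring

theorem cosMoment_odd (m : ℕ) : cosMoment (2 * m + 1) = 0 := by
  induction m with
  | zero => exact cosMoment_one
  | succ m ih => rw [show 2 * (m + 1) + 1 = 2 * m + 1 + 2 by ring, cosMoment_add_two, ih, mul_zero]

theorem poch_zero (x : ℂ) : poch x 0 = 1 := by simp [poch]

theorem cosMoment_even (m : ℕ) :
    (cosMoment (2 * m) : ℂ) = 4 ^ m * poch (1 / 2) m / m.factorial := by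
  induction m with
  | zero => simp [cosMoment_zero, poch_zero]
  | succ m ih =>
    rw [show 2 * (m + 1) = 2 * m + 2 by ring, cosMoment_add_two, Complex.ofReal_mul, ih, poch_succ,
      Nat.factorial_succ]
    have h1 : (m.factorial : ℂ) ≠ 0 := by exact_mod_cast m.factorial_ne_zero
    have h2 : (m + 1 : ℂ) ≠ 0 := by exact_mod_cast m.succ_ne_zero
    have h3 : (2 * m + 2 : ℂ) ≠ 0 := by exact_mod_cast (2 * m + 1).succ_ne_zero
    push_cast
    field_simp
    ring

theorem Ring.choose_complex_succ (s : ℂ) (n : ℕ) :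
    Ring.choose s (n + 1) = (s - n) / (n + 1) * Ring.choose s n := by
  have h1 : (n.factorial : ℂ) ≠ 0 := by exact_mod_cast n.factorial_ne_zero
  have h2 : (n + 1 : ℂ) ≠ 0 := by exact_mod_cast n.succ_ne_zero
  simp only [Ring.choose_eq_smul, descPochhammer_succ_right, Polynomial.smeval_mul,
    Polynomial.smeval_sub, Polynomial.smeval_X, Polynomial.smeval_natCast, Nat.factorial_succ,
    smul_eq_mul, pow_one, pow_zero, nsmul_eq_mul, mul_one]
  push_cast
  field_simp

theorem Ring.choose_mul_cosMoment (s : ℂ) (m : ℕ) :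
    Ring.choose s (2 * m) * cosMoment (2 * m) =
      poch (-s / 2) m * poch ((1 - s) / 2) m / (m.factorial : ℂ) ^ 2 * 4 ^ m := by
  induction m with
  | zero => simp [cosMoment_zero, poch_zero]
  | succ m ih =>
    have h1 : (m.factorial : ℂ) ≠ 0 := by exact_mod_cast m.factorial_ne_zero
    have h2 : (m + 1 : ℂ) ≠ 0 := by exact_mod_cast m.succ_ne_zero
    have h3 : (2 * m + 2 : ℂ) ≠ 0 := by exact_mod_cast (2 * m + 1).succ_ne_zero
    have h4 : (2 * m + 1 : ℂ) ≠ 0 := by exact_mod_cast (2 * m).succ_ne_zero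
    calc Ring.choose s (2 * (m + 1)) * cosMoment (2 * (m + 1))
      _ = (s - (2 * m + 1)) / (2 * m + 2) * ((s - 2 * m) / (2 * m + 1)) *
            (4 * ((2 * m + 1) / (2 * m + 2))) *
            (Ring.choose s (2 * m) * cosMoment (2 * m)) := by
        rw [show 2 * (m + 1) = 2 * m + 1 + 1 by ring, Ring.choose_complex_succ,
          Ring.choose_complex_succ, cosMoment_add_two]
        push_cast
        ring
      _ = _ := by
        rw [ih, poch_succ, poch_succ, Nat.factorial_succ]
        push_cast
        field_simp
        ring

theorem summable_choose_mul_pow (s : ℂ) {ρ : ℝ} (h0 : 0 ≤ ρ) (h1 : ρ < 1) :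
    Summable fun n => ‖Ring.choose s n‖ * ρ ^ n := by
  have hmem : (ρ : ℂ) ∈ Metric.eball (0 : ℂ) (binomialSeries ℂ s).radius := by
    refine Metric.eball_subset_eball binomialSeries_radius_ge_one ?_
    rw [← ENNReal.ofReal_one, Metric.eball_ofReal]
    simpa [abs_of_nonneg h0] using h1
  refine ((binomialSeries ℂ s).summable_norm_apply hmem).congr fun n => ?_
  rw [binomialSeries_apply]
  simp [abs_of_nonneg h0]

theorem hasSum_exp_mul_log_one_add (s : ℂ) {x : ℝ} (hx : |x| < 1) :
    HasSum (fun n => Ring.choose s n * (x : ℂ) ^ n) (Complex.exp (s * Real.log (1 + x))) := by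
  have hpos : 0 < 1 + x := by linarith [(abs_lt.mp hx).1]
  have hmem : (x : ℂ) ∈ Metric.eball (0 : ℂ) 1 := by
    rw [← ENNReal.ofReal_one, Metric.eball_ofReal]
    simpa using hx
  have h := (Complex.one_add_cpow_hasFPowerSeriesOnBall_zero (a := s)).hasSum hmem
  have hne : (1 + x : ℂ) ≠ 0 := by exact_mod_cast hpos.ne'
  rw [Complex.ofReal_log hpos.le]
  simpa only [binomialSeries_apply, List.ofFn_const, List.prod_replicate, smul_eq_mul, zero_add,
    Complex.cpow_def_of_ne_zero hne, mul_comm s, Complex.ofReal_add, Complex.ofReal_one] using h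

theorem cpow0_abs_add (s : ℂ) {k p : ℝ} (hp : |p| < |k|) :
    cpow0 |k + p| s = cpow0 |k| s * Complex.exp (s * Real.log (1 + p / k)) := by
  have hk : k ≠ 0 := abs_pos.mp ((abs_nonneg p).trans_lt hp)
  have hx : |p / k| < 1 := by rwa [abs_div, div_lt_one (abs_pos.mpr hk)]
  have hpos : 0 < 1 + p / k := by linarith [(abs_lt.mp hx).1]
  have hfac : |k + p| = |k| * (1 + p / k) := by
    rw [← abs_of_pos hpos, ← abs_mul]
    congr 1
    field_simp
  have hk' : |k| ≠ 0 := abs_ne_zero.mpr hk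
  rw [hfac, cpow0, cpow0, if_neg hk', if_neg (mul_ne_zero hk' hpos.ne'),
    Real.log_mul hk' hpos.ne', ← Complex.exp_add]
  push_cast
  ring_nf

theorem abs_prod_two_mul_cos_le {r : ℕ} (θ : Fin r → ℝ) :
    |∏ i, 2 * Real.cos (θ i)| ≤ 2 ^ r := by
  rw [Finset.abs_prod]
  calc ∏ i, |2 * Real.cos (θ i)| ≤ ∏ _i : Fin r, (2 : ℝ) := by
        refine Finset.prod_le_prod (fun _ _ => abs_nonneg _) fun i _ => ?_
        rw [abs_mul, abs_two]
        linarith [Real.abs_cos_le_one (θ i)]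
    _ = 2 ^ r := by simp

theorem integral_prod_two_mul_cos_pow (r n : ℕ) :
    ((2 * π : ℝ) : ℂ)⁻¹ ^ r * ∫ θ : Fin r → ℝ in Set.univ.pi fun _ => Set.Icc 0 (2 * π),
      ((∏ i, 2 * Real.cos (θ i) : ℝ) : ℂ) ^ n = (cosMoment n : ℂ) ^ r := by
  have h : ∫ θ : Fin r → ℝ in Set.univ.pi fun _ => Set.Icc 0 (2 * π),
      (∏ i, 2 * Real.cos (θ i)) ^ n = (∫ x in Set.Icc 0 (2 * π), (2 * Real.cos x) ^ n) ^ r := by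
    simp_rw [← Finset.prod_pow]
    rw [volume_pi, Measure.restrict_pi_pi,
      integral_fintype_prod_eq_pow fun x : ℝ => (2 * Real.cos x) ^ n, Fintype.card_fin]
  simp_rw [← Complex.ofReal_pow, ← Complex.ofReal_inv]
  rw [integral_complex_ofReal, h, cosMoment, mul_pow, Complex.ofReal_mul, Complex.ofReal_pow,
    Complex.ofReal_pow]

theorem hasSum_Wr (r : ℕ) {k : ℝ} (hk : (2 : ℝ) ^ r < |k|) (s : ℂ) :
    HasSum (fun n => cpow0 |k| s * (Ring.choose s n * (cosMoment n : ℂ) ^ r / (k : ℂ) ^ n))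
      (Wr r k s) := by
  have hk0 : 0 < |k| := lt_trans (by positivity) hk
  have hρ0 : 0 ≤ 2 ^ r / |k| := by positivity
  have hρ1 : 2 ^ r / |k| < 1 := (div_lt_one hk0).mpr hk
  have hint := hasSum_integral_of_dominated_convergence
    (μ := volume.restrict (Set.univ.pi fun _ : Fin r => Set.Icc 0 (2 * π)))
    (F := fun n θ => cpow0 |k| s *
      (Ring.choose s n * (((∏ i, 2 * Real.cos (θ i)) / k : ℝ) : ℂ) ^ n))
    (f := fun θ => cpow0 |k + ∏ i, 2 * Real.cos (θ i)| s)
    (fun n _ => ‖cpow0 |k| s‖ * (‖Ring.choose s n‖ * (2 ^ r / |k|) ^ n))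
    (fun n => Continuous.aestronglyMeasurable (by fun_prop))
    (fun n => Filter.Eventually.of_forall fun θ => by
      rw [norm_mul, norm_mul, norm_pow, Complex.norm_real, Real.norm_eq_abs, abs_div]
      gcongr
      exact abs_prod_two_mul_cos_le θ)
    (Filter.Eventually.of_forall fun θ => (summable_choose_mul_pow s hρ0 hρ1).mul_left _)
    (by
      have : IsFiniteMeasure
          (volume.restrict (Set.univ.pi fun _ : Fin r => Set.Icc 0 (2 * π))) :=
        isFiniteMeasure_restrict.mpr
          (isCompact_univ_pi fun _ => isCompact_Icc).measure_lt_top.ne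
      exact integrable_const _)
    (Filter.Eventually.of_forall fun θ => by
      have hp := (abs_prod_two_mul_cos_le θ).trans_lt hk
      rw [cpow0_abs_add s hp]
      refine (hasSum_exp_mul_log_one_add s ?_).mul_left _
      rwa [abs_div, div_lt_one hk0])
  refine (hint.mul_left (((2 * π : ℝ) : ℂ)⁻¹ ^ r)).congr_fun fun n => ?_
  simp only [Complex.ofReal_div, div_pow, integral_const_mul, integral_div]
  rw [← integral_prod_two_mul_cos_pow]
  ring

/-- For `r ≥ 1` and `|k| > 2^r`:
`W_r(k;s) = |k|^s · ₍r+1₎F_r(−s/2, (1−s)/2, 1/2, …, 1/2; 1, …, 1; 4^r/k²)`. -/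
theorem stmt6 (r : ℕ) (hr : 1 ≤ r) (k : ℝ) (hk : (2 : ℝ) ^ r < |k|) (s : ℂ) :
    Wr r k s = cpow0 |k| s *
      ∑' n : ℕ, poch (-s / 2) n * poch ((1 - s) / 2) n * (poch (1/2) n) ^ (r - 1) /
        ((n.factorial : ℂ)) ^ (r + 1) * ((4 : ℂ) ^ r / (k : ℂ) ^ 2) ^ n := by
  have hodd : ∀ n ∉ Set.range fun m : ℕ => 2 * m,
      cpow0 |k| s * (Ring.choose s n * (cosMoment n : ℂ) ^ r / (k : ℂ) ^ n) = 0 := by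
    intro n hn
    obtain ⟨m, rfl | rfl⟩ := n.even_or_odd'
    · exact absurd ⟨m, rfl⟩ hn
    · simp [cosMoment_odd, Nat.one_le_iff_ne_zero.mp hr]
  have hinj : Function.Injective fun m : ℕ => 2 * m := mul_right_injective₀ two_ne_zero
  rw [← ((hinj.hasSum_iff hodd).mpr (hasSum_Wr r hk s)).tsum_eq, ← tsum_mul_left]
  refine tsum_congr fun m => ?_
  obtain ⟨q, rfl⟩ := Nat.exists_eq_add_of_le' hr
  simp only [Function.comp_apply, Nat.add_sub_cancel]
  rw [pow_succ (cosMoment (2 * m) : ℂ), mul_comm (_ ^ q), ← mul_assoc (Ring.choose s _),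
    Ring.choose_mul_cosMoment, cosMoment_even]
  have h1 : (m.factorial : ℂ) ≠ 0 := by exact_mod_cast m.factorial_ne_zero
  simp only [div_pow, mul_pow, ← pow_mul]
  field_simp
  ring
end

section
/- Let k be a real number with |k| < 4. Then the logarithmic Mahler measure of k + (x+x⁻¹)(y+y⁻¹) satisfies (2π)^{−2} ∫_{[0,2π]²} log|k + 4cos θ₁ cos θ₂| dθ₁dθ₂ = (|k|/4) · ₃F₂(1/2, 1/2, 1/2; 1, 3/2; k²/16), where the series converges since k²/16 < 1. -/
open MeasureTheory Real

/-- Pochhammer symbol `(x)ₙ = x (x+1) ⋯ (x+n-1)` in `ℝ`. -/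
noncomputable def pochR (x : ℝ) (n : ℕ) : ℝ := (ascPochhammer ℝ n).eval x

lemma pochR_zero (x : ℝ) : pochR x 0 = 1 := by simp [pochR]

lemma pochR_succ (x : ℝ) (n : ℕ) : pochR x (n + 1) = pochR x n * (x + n) := by
  simp [pochR, ascPochhammer_succ_eval]

lemma pochR_one (n : ℕ) : pochR 1 n = n.factorial := by
  induction n with
  | zero => simp [pochR_zero]
  | succ n ih => rw [pochR_succ, ih, Nat.factorial_succ]; push_cast; ring

lemma pochR_half_pos (n : ℕ) : 0 < pochR (1 / 2) n := by
  induction n with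
  | zero => simp [pochR_zero]
  | succ n ih => rw [pochR_succ]; positivity

lemma pochR_three_halves (n : ℕ) : pochR (3 / 2) n = (2 * n + 1) * pochR (1 / 2) n := by
  induction n with
  | zero => simp [pochR_zero]
  | succ n ih => rw [pochR_succ, pochR_succ, ih]; push_cast; ring

lemma prod_range_odd_div_even (n : ℕ) :
    ∏ i ∈ Finset.range n, (2 * (i : ℝ) + 1) / (2 * i + 2) = pochR (1 / 2) n / n.factorial := by
  induction n with
  | zero => simp [pochR_zero]
  | succ n ih =>
    rw [Finset.prod_range_succ, ih, pochR_succ, Nat.factorial_succ]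
    push_cast
    field_simp
    ring

lemma hasSum_one_div_sqrt_one_sub {x : ℝ} (hx : |x| < 1) :
    HasSum (fun n : ℕ => pochR (1 / 2) n / n.factorial * x ^ n) (1 / √(1 - x)) := by
  have h := (one_div_one_sub_rpow_hasFPowerSeriesOnBall_zero (1 / 2)).hasSum
    (y := x) (by simpa [enorm_eq_nnnorm, ← NNReal.coe_lt_one] using hx)
  have hcoeff (n : ℕ) : Ring.choose ((1 / 2 : ℝ) + n - 1) n = pochR (1 / 2) n / n.factorial := by
    have h := Ring.factorial_nsmul_multichoose_eq_ascPochhammer (1 / 2 : ℝ) n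
    rw [Ring.multichoose_eq, nsmul_eq_mul, Polynomial.ascPochhammer_smeval_eq_eval] at h
    rw [eq_div_iff (by positivity), mul_comm, h, pochR]
  simp only [hcoeff] at h
  simpa [sqrt_eq_rpow, mul_comm] using h

lemma integral_cos_pow_even_zero_pi_div_two (n : ℕ) :
    ∫ x in 0..π / 2, cos x ^ (2 * n) = π / 2 * (pochR (1 / 2) n / n.factorial) := by
  rw [EulerSine.integral_cos_pow_eq, integral_sin_pow_even, prod_range_odd_div_even]
  ring

/-- The inverse Gudermannian `log ((1 + sin x) / cos x)`. -/
noncomputable def logSecAddTan (x : ℝ) : ℝ := log (1 + sin x) - log (cos x)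

lemma intervalIntegrable_logSecAddTan :
    IntervalIntegrable logSecAddTan volume 0 (π / 2) := by
  refine IntervalIntegrable.sub (ContinuousOn.intervalIntegrable ?_) intervalIntegrable_log_cos
  intro x hx
  rw [Set.uIcc_of_le (by positivity)] at hx
  have := sin_nonneg_of_nonneg_of_le_pi hx.1 (by linarith [hx.2, pi_pos])
  exact ((by fun_prop : ContinuousAt (fun x => 1 + sin x) x).log (by positivity)).continuousWithinAt

lemma logSecAddTan_nonneg {x : ℝ} (hx : x ∈ Set.Ioo 0 (π / 2)) : 0 ≤ logSecAddTan x := by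
  have h1 := sin_nonneg_of_nonneg_of_le_pi hx.1.le (by linarith [hx.2, pi_pos])
  have h2 := cos_pos_of_mem_Ioo (x := x) ⟨by linarith [hx.1, pi_pos], hx.2⟩
  have := log_nonneg (x := 1 + sin x) (by linarith)
  have := log_nonpos h2.le (cos_le_one x)
  unfold logSecAddTan
  linarith

lemma hasDerivAt_logSecAddTan {x : ℝ} (hx : x ∈ Set.Ioo 0 (π / 2)) :
    HasDerivAt logSecAddTan (1 / cos x) x := by
  have h1 := sin_nonneg_of_nonneg_of_le_pi hx.1.le (by linarith [hx.2, pi_pos])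
  have h2 := cos_pos_of_mem_Ioo (x := x) ⟨by linarith [hx.1, pi_pos], hx.2⟩
  have h3 : 1 + sin x ≠ 0 := by positivity
  convert! (((hasDerivAt_sin x).const_add 1).log h3).sub ((hasDerivAt_cos x).log h2.ne') using 1
  field_simp
  linear_combination -(sin_sq_add_cos_sq x)

lemma integral_logSecAddTan_mul (n : ℕ) :
    ∫ x in 0..π / 2, logSecAddTan x * (sin x * cos x ^ (2 * n)) =
      π / 2 * (pochR (1 / 2) n / n.factorial) / (2 * n + 1) := by
  have hint : IntervalIntegrable (fun x => logSecAddTan x * (sin x * cos x ^ (2 * n))) volume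
      0 (π / 2) := intervalIntegrable_logSecAddTan.mul_continuousOn (by fun_prop)
  have hint' : IntervalIntegrable (fun x => cos x ^ (2 * n) / (2 * n + 1)) volume
      0 (π / 2) := Continuous.intervalIntegrable (by fun_prop) _ _
  have key := intervalIntegral.integral_eq_sub_of_hasDerivAt_of_le (a := 0) (b := π / 2)
    (f := fun x => -(cos x ^ (2 * n) * (cos x * log (1 + sin x) - cos x * log (cos x))) / (2 * n + 1))
    (by positivity) ?_ ?_ (hint.sub hint')
  · rw [intervalIntegral.integral_sub hint hint', intervalIntegral.integral_div,
      integral_cos_pow_even_zero_pi_div_two] at key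
    simp at key
    rw [sub_eq_zero.1 key]
    norm_num
  · intro x hx
    have := sin_nonneg_of_nonneg_of_le_pi hx.1 (by linarith [hx.2, pi_pos])
    have h1 : ContinuousAt (fun x => log (1 + sin x)) x :=
      (by fun_prop : ContinuousAt (fun x => 1 + sin x) x).log (by positivity)
    have h2 : Continuous (fun x => cos x * log (cos x)) := continuous_mul_log.comp continuous_cos
    have h3 := h2.continuousAt (x := x)
    exact ContinuousAt.continuousWithinAt (by fun_prop)
  · intro x hx
    have h2 := cos_pos_of_mem_Ioo (x := x) ⟨by linarith [hx.1, pi_pos], hx.2⟩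
    have := ((((hasDerivAt_cos x).pow (2 * n + 1)).mul (hasDerivAt_logSecAddTan hx)).neg).div_const
      (2 * n + 1 : ℝ)
    convert! this using 1
    · ext y
      simp [logSecAddTan]
      ring
    · simp
      field_simp
      ring

lemma hasSum_integral_logSecAddTan {c : ℝ} (hc0 : 0 < c) (hc1 : c < 1) :
    HasSum (fun n : ℕ => π / 2 * (pochR (1 / 2) n / n.factorial) ^ 2 / (2 * n + 1) * (c ^ 2) ^ n)
      (∫ x in 0..π / 2, logSecAddTan x * (sin x / √(1 - (c * cos x) ^ 2))) := by
  have hsum := hasSum_one_div_sqrt_one_sub (x := c ^ 2) (by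
    rw [abs_of_nonneg (by positivity)]; nlinarith)
  have hpos (n : ℕ) := pochR_half_pos n
  have := intervalIntegral.hasSum_integral_of_dominated_convergence (a := 0) (b := π / 2)
    (μ := volume)
    (F := fun (n : ℕ) x => (pochR (1 / 2) n / n.factorial * (c ^ 2) ^ n) *
      (logSecAddTan x * (sin x * cos x ^ (2 * n))))
    (f := fun x => logSecAddTan x * (sin x / √(1 - (c * cos x) ^ 2)))
    (fun n x => logSecAddTan x * (pochR (1 / 2) n / n.factorial * (c ^ 2) ^ n)) ?_ ?_ ?_ ?_ ?_
  · convert! this using 2 with n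
    rw [intervalIntegral.integral_const_mul, integral_logSecAddTan_mul]
    ring
  · intro n
    refine AEStronglyMeasurable.const_mul ?_ _
    have : IntervalIntegrable (fun x => logSecAddTan x * (sin x * cos x ^ (2 * n))) volume
      0 (π / 2) := intervalIntegrable_logSecAddTan.mul_continuousOn (by fun_prop)
    exact this.def'.aestronglyMeasurable
  · intro n
    filter_upwards [compl_mem_ae_iff.2 (measure_singleton (π / 2))] with x hx hx'
    rw [Set.uIoc_of_le (by positivity)] at hx'
    have hx2 : x ∈ Set.Ioo 0 (π / 2) := ⟨hx'.1, lt_of_le_of_ne hx'.2 hx⟩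
    have h0 := logSecAddTan_nonneg hx2
    have h1 : |sin x| * |cos x| ^ (2 * n) ≤ 1 :=
      mul_le_one₀ (abs_sin_le_one x) (by positivity)
        (pow_le_one₀ (abs_nonneg _) (abs_cos_le_one x))
    have h2 := hpos n
    rw [norm_mul, norm_of_nonneg (by positivity), norm_mul, norm_of_nonneg h0, norm_mul, norm_pow,
      norm_eq_abs, norm_eq_abs, mul_comm]
    gcongr
    exact mul_le_of_le_one_right h0 h1
  · exact .of_forall fun x _ => hsum.summable.mul_left _
  · simp_rw [tsum_mul_left]
    exact intervalIntegrable_logSecAddTan.mul_const _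
  · refine .of_forall fun x _ => ?_
    have := hasSum_one_div_sqrt_one_sub (x := (c * cos x) ^ 2) (by
      rw [abs_of_nonneg (by positivity), mul_pow]; nlinarith [cos_sq_le_one x, sq_nonneg (cos x)])
    convert! this.mul_left (logSecAddTan x * sin x) using 1
    · ext n
      simp only [mul_pow, pow_mul]
      ring
    · ring

/-- The excess of the circle average of `log |c + s * cos θ|` over its value `log (s / 2)`
for `c ≤ s`. -/
noncomputable def arcoshRatio (c s : ℝ) : ℝ := if s < c then log ((c + √(c ^ 2 - s ^ 2)) / s) else 0

lemma arcoshRatio_nonneg {c s : ℝ} (hs : 0 < s) : 0 ≤ arcoshRatio c s := by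
  unfold arcoshRatio
  split_ifs with h
  · exact log_nonneg ((one_le_div hs).2 (by linarith [sqrt_nonneg (c ^ 2 - s ^ 2)]))
  · rfl

lemma arcoshRatio_mul {a c s : ℝ} (ha : 0 < a) :
    arcoshRatio (a * c) (a * s) = arcoshRatio c s := by
  have h : √((a * c) ^ 2 - (a * s) ^ 2) = a * √(c ^ 2 - s ^ 2) := by
    rw [← sqrt_sq ha.le, ← sqrt_mul (sq_nonneg _), sqrt_sq ha.le]
    ring_nf
  simp only [arcoshRatio, mul_lt_mul_iff_right₀ ha, h, ← mul_add, mul_div_mul_left _ _ ha.ne']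

lemma arcoshRatio_mul_cos {c x : ℝ} (hc : 0 < c) (hx : x ∈ Set.Ioo 0 (π / 2)) :
    arcoshRatio c (c * cos x) = logSecAddTan x := by
  have h1 := sin_pos_of_pos_of_lt_pi hx.1 (by linarith [hx.2, pi_pos])
  have h2 := cos_pos_of_mem_Ioo (x := x) ⟨by linarith [hx.1, pi_pos], hx.2⟩
  have h3 : cos x < 1 := by nlinarith [sin_sq_add_cos_sq x]
  have h4 : √(c ^ 2 - (c * cos x) ^ 2) = c * sin x := by
    rw [← sqrt_sq (by positivity : 0 ≤ c * sin x)]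
    congr 1
    linear_combination -c ^ 2 * sin_sq_add_cos_sq x
  rw [arcoshRatio, if_pos (by nlinarith), h4, logSecAddTan, ← log_div (by positivity) h2.ne']
  congr 1
  field_simp

lemma image_arccos_mul_cos {c : ℝ} (hc0 : 0 < c) (hc1 : c < 1) :
    (fun x => arccos (c * cos x)) '' Set.Ioo 0 (π / 2) = Set.Ioo (arccos c) (π / 2) := by
  ext y
  simp only [Set.mem_image, Set.mem_Ioo]
  constructor
  · rintro ⟨x, hx, rfl⟩
    have h1 := sin_pos_of_pos_of_lt_pi hx.1 (by linarith [hx.2, pi_pos])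
    have h2 := cos_pos_of_mem_Ioo (x := x) ⟨by linarith [hx.1, pi_pos], hx.2⟩
    have h3 : cos x < 1 := by nlinarith [sin_sq_add_cos_sq x]
    exact ⟨strictAntiOn_arccos ⟨by nlinarith, by nlinarith⟩ ⟨by linarith, hc1.le⟩ (by nlinarith),
      arccos_lt_pi_div_two.2 (by positivity)⟩
  · rintro ⟨hy1, hy2⟩
    have hy0 := (arccos_nonneg c).trans_lt hy1
    have h2 := cos_pos_of_mem_Ioo (x := y) ⟨by linarith, hy2⟩
    have h3 : cos y < c := by
      rw [← cos_arccos (x := c) (by linarith) hc1.le]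
      exact cos_lt_cos_of_nonneg_of_le_pi (arccos_nonneg c) (by linarith [pi_pos]) hy1
    refine ⟨arccos (cos y / c), ⟨arccos_pos.2 ((div_lt_one hc0).2 h3),
      arccos_lt_pi_div_two.2 (by positivity)⟩, ?_⟩
    rw [cos_arccos (by have : 0 < cos y / c := by positivity
                       linarith) ((div_lt_one hc0).2 h3).le,
      mul_div_cancel₀ _ hc0.ne', arccos_cos hy0.le (by linarith [pi_pos])]

lemma integral_arcoshRatio_cos {c : ℝ} (hc0 : 0 < c) (hc1 : c < 1) :
    ∫ x in 0..π / 2, arcoshRatio c (cos x) =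
      c * ∫ x in 0..π / 2, logSecAddTan x * (sin x / √(1 - (c * cos x) ^ 2)) := by
  have hbd {x : ℝ} (hx : x ∈ Set.Ioo 0 (π / 2)) : 0 < c * cos x ∧ c * cos x < 1 := by
    have h2 := cos_pos_of_mem_Ioo (x := x) ⟨by linarith [hx.1, pi_pos], hx.2⟩
    exact ⟨by positivity, by nlinarith [cos_le_one x]⟩
  have hsub : Set.Ioo (arccos c) (π / 2) ⊆ Set.Ioo 0 (π / 2) :=
    Set.Ioo_subset_Ioo_left (arccos_nonneg c)
  rw [intervalIntegral.integral_of_le (by positivity), intervalIntegral.integral_of_le (by positivity),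
    integral_Ioc_eq_integral_Ioo, integral_Ioc_eq_integral_Ioo,
    setIntegral_eq_of_subset_of_forall_sdiff_eq_zero measurableSet_Ioo hsub,
    ← image_arccos_mul_cos hc0 hc1,
    integral_image_eq_integral_abs_deriv_smul (f' := fun x => c * sin x / √(1 - (c * cos x) ^ 2))
      measurableSet_Ioo, ← integral_const_mul]
  · refine setIntegral_congr_fun measurableSet_Ioo fun x hx => ?_
    have h1 := sin_pos_of_pos_of_lt_pi hx.1 (by linarith [hx.2, pi_pos])
    have h2 := hbd hx
    rw [cos_arccos (by linarith) h2.2.le, arcoshRatio_mul_cos hc0 hx, abs_of_nonneg (by positivity),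
      smul_eq_mul]
    ring
  · intro x hx
    have h2 := hbd hx
    have := (hasDerivAt_arccos (x := c * cos x) (by linarith) h2.2.ne).comp x
      ((hasDerivAt_cos x).const_mul c)
    refine HasDerivAt.hasDerivWithinAt ?_
    convert! this using 1
    ring
  · intro x hx y hy hxy
    have h2 := hbd hx
    have h3 := hbd hy
    have := arccos_injOn ⟨by linarith, h2.2.le⟩ ⟨by linarith, h3.2.le⟩ hxy
    exact injOn_cos ⟨hx.1.le, by linarith [hx.2, pi_pos]⟩ ⟨hy.1.le, by linarith [hy.2, pi_pos]⟩
      (mul_left_cancel₀ hc0.ne' this)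
  · rintro x ⟨hx, hx'⟩
    have h : x ≤ arccos c := by
      by_contra! h
      exact hx' ⟨h, hx.2⟩
    have := cos_le_cos_of_nonneg_of_le_pi hx.1.le (arccos_le_pi c) h
    rw [cos_arccos (by linarith) hc1.le] at this
    rw [arcoshRatio, if_neg this.not_gt]

lemma exists_roots_posLog_add (k : ℝ) {b : ℝ} (hb : b ≠ 0) :
    ∃ r s : ℂ, r + s = -(2 * k / b) ∧ r * s = 1 ∧
      log⁺ ‖r‖ + log⁺ ‖s‖ = arcoshRatio |k| |b| := by
  have hb' : 0 < |b| := abs_pos.2 hb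
  have hbC : (b : ℂ) ≠ 0 := by exact_mod_cast hb
  rcases lt_or_ge |b| |k| with h | h
  · obtain ⟨ε, hε, hk⟩ : ∃ ε : ℝ, |ε| = 1 ∧ k = ε * |k| := by
      rcases abs_cases k with h | h
      · exact ⟨1, by simp, by linarith⟩
      · exact ⟨-1, by simp, by linarith⟩
    have hε2 : ε ^ 2 = 1 := by rw [← sq_abs, hε, one_pow]
    set d := √(|k| ^ 2 - |b| ^ 2) with hd
    have hd0 : 0 ≤ d := sqrt_nonneg _
    have hd2 : d ^ 2 = |k| ^ 2 - |b| ^ 2 := sq_sqrt (by nlinarith)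
    have hdk : d ≤ |k| := by nlinarith [abs_nonneg k]
    have h1 : |-(ε * (|k| + d) / b)| = (|k| + d) / |b| := by
      rw [abs_neg, abs_div, abs_mul, hε, one_mul, abs_of_nonneg (by positivity)]
    have h2 : |-(ε * (|k| - d) / b)| = (|k| - d) / |b| := by
      rw [abs_neg, abs_div, abs_mul, hε, one_mul, abs_of_nonneg (by linarith)]
    refine ⟨(-(ε * (|k| + d) / b) : ℝ), (-(ε * (|k| - d) / b) : ℝ), ?_, ?_, ?_⟩
    · rw [← Complex.ofReal_add]
      norm_cast
      field_simp
      linear_combination 2 * hk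
    · rw [← Complex.ofReal_mul]
      norm_cast
      field_simp
      rw [sq_abs b] at hd2
      linear_combination -hd2 + (|k| ^ 2 - d ^ 2) * hε2
    · rw [Complex.norm_real, Complex.norm_real, norm_eq_abs, norm_eq_abs, h1, h2,
        posLog_eq_log, posLog_eq_zero_iff _ |>.2, add_zero, arcoshRatio, if_pos h]
      · rw [abs_of_nonneg (div_nonneg (by linarith) hb'.le), div_le_one hb']
        nlinarith
      · rw [abs_of_nonneg (by positivity), one_le_div hb']
        linarith
  · set e := √(b ^ 2 - k ^ 2) with he
    have he2 : e ^ 2 = b ^ 2 - k ^ 2 := sq_sqrt (sub_nonneg.2 (sq_le_sq.2 h))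
    have he2C : (e : ℂ) ^ 2 = b ^ 2 - k ^ 2 := by exact_mod_cast he2
    have hnorm (z : ℂ) (hz : z.re ^ 2 + z.im ^ 2 = b ^ 2) : ‖z / b‖ = 1 := by
      rw [norm_div, Complex.norm_real, norm_eq_abs, Complex.norm_eq_sqrt_sq_add_sq, hz, sqrt_sq_eq_abs,
        div_self hb'.ne']
    have hre : log⁺ (1 : ℝ) = 0 := by simp
    refine ⟨(-k + e * Complex.I) / b, (-k - e * Complex.I) / b, ?_, ?_, ?_⟩
    · field_simp
      ring
    · field_simp
      linear_combination he2C - (e : ℂ) ^ 2 * Complex.I_sq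
    · rw [hnorm _ (by simp; linarith), hnorm _ (by simp; linarith), hre, arcoshRatio,
        if_neg h.not_gt, add_zero]

open Polynomial in
lemma integral_log_abs_add_mul_cos (k : ℝ) {b : ℝ} (hb : b ≠ 0) :
    ∫ x in 0..2 * π, log |k + b * cos x| =
      2 * π * (log (|b| / 2) + arcoshRatio |k| |b|) := by
  obtain ⟨r, s, hsum, hprod, hlog⟩ : ∃ r s : ℂ, r + s = -(2 * k / b) ∧ r * s = 1 ∧
      log⁺ ‖r‖ + log⁺ ‖s‖ = arcoshRatio |k| |b| :=
    exists_roots_posLog_add k hb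
  have hb' : (b : ℂ) ≠ 0 := by exact_mod_cast hb
  have hpos : (2 * π) ≠ 0 := by positivity
  have key : (C (b / 2 : ℂ) * ((X - C r) * (X - C s))).logMahlerMeasure =
      log (|b| / 2) + arcoshRatio |k| |b| := by
    rw [logMahlerMeasure_C_mul (by simpa using hb)
        (mul_ne_zero (X_sub_C_ne_zero r) (X_sub_C_ne_zero s)),
      logMahlerMeasure_mul_eq_add_logMahlerMeasure
        (mul_ne_zero (X_sub_C_ne_zero r) (X_sub_C_ne_zero s)),
      logMahlerMeasure_X_sub_C, logMahlerMeasure_X_sub_C, hlog]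
    simp
  rw [← key, logMahlerMeasure_def, circleAverage_def, smul_eq_mul, mul_inv_cancel_left₀ hpos]
  refine intervalIntegral.integral_congr fun x _ => ?_
  have h1 : (C (b / 2 : ℂ) * ((X - C r) * (X - C s))).eval (circleMap 0 1 x) =
      circleMap 0 1 x * ((k + b * cos x : ℝ) : ℂ) := by
    have he : Complex.exp (x * Complex.I) * Complex.exp (-x * Complex.I) = 1 := by
      rw [← Complex.exp_add]; simp
    have h2 : (b : ℂ) * (r + s) = -(2 * k) := by rw [hsum]; field_simp
    simp only [eval_mul, eval_C, eval_sub, eval_X, circleMap, Complex.ofReal_add, Complex.ofReal_mul,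
      Complex.ofReal_cos, Complex.cos]
    simp only [zero_add, Complex.ofReal_one, one_mul]
    linear_combination (-Complex.exp (x * Complex.I) / 2) * h2 + (b : ℂ) / 2 * hprod -
      (b : ℂ) / 2 * he
  simp only [h1, norm_mul, norm_circleMap_zero, Complex.norm_real, norm_eq_abs, abs_one, one_mul]

lemma integral_comp_abs_cos {g : ℝ → ℝ}
    (hg : IntervalIntegrable (fun x => g |cos x|) volume 0 (2 * π)) :
    ∫ x in 0..2 * π, g |cos x| = 4 * ∫ x in 0..π / 2, g (cos x) := by
  have hpi := pi_pos
  have hint {a b : ℝ} (ha : 0 ≤ a) (hab : a ≤ b) (hb : b ≤ 2 * π) :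
      IntervalIntegrable (fun x => g |cos x|) volume a b :=
    hg.mono_set (by
      rw [Set.uIcc_of_le hab, Set.uIcc_of_le (by linarith)]
      exact Set.Icc_subset_Icc ha hb)
  have h1 : ∫ x in π..2 * π, g |cos x| = ∫ x in 0..π, g |cos x| := by
    have := intervalIntegral.integral_comp_add_right (fun x => g |cos x|) (a := 0) (b := π) π
    rw [zero_add, ← two_mul] at this
    simp [← this]
  have h2 : ∫ x in π / 2..π, g |cos x| = ∫ x in 0..π / 2, g |cos x| := by
    have := intervalIntegral.integral_comp_sub_left (fun x => g |cos x|) (a := 0) (b := π / 2) π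
    rw [sub_zero, sub_half] at this
    simp [← this]
  have h3 : ∫ x in 0..π / 2, g |cos x| = ∫ x in 0..π / 2, g (cos x) := by
    refine intervalIntegral.integral_congr fun x hx => ?_
    rw [Set.uIcc_of_le (by positivity)] at hx
    simp only [abs_of_nonneg (cos_nonneg_of_mem_Icc ⟨by linarith [hx.1], hx.2⟩)]
  rw [← intervalIntegral.integral_add_adjacent_intervals (b := π) (hint (by linarith) (by linarith)
      (by linarith)) (hint (by linarith) (by linarith) (by linarith)), h1,
    ← intervalIntegral.integral_add_adjacent_intervals (b := π / 2) (hint (by linarith) (by linarith)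
      (by linarith)) (hint (by linarith) (by linarith) (by linarith)), h2, h3]
  ring

lemma integral_log_cos_zero_two_pi : ∫ x in 0..2 * π, log (cos x) = 2 * π * (-log 2) := by
  have h := integral_comp_abs_cos (g := log) (by simpa using! intervalIntegrable_log_cos)
  have h2 : ∫ x in 0..π / 2, log (cos x) = ∫ x in 0..π / 2, log (sin x) := by
    have := intervalIntegral.integral_comp_sub_left (fun x => log (sin x)) (a := 0) (b := π / 2)
      (π / 2)
    simpa [sin_pi_div_two_sub] using this
  simp only [log_abs] at h
  rw [h, h2, integral_log_sin_zero_pi_div_two]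
  ring

lemma ae_cos_ne_zero : ∀ᵐ x : ℝ, cos x ≠ 0 := by
  have h : {x : ℝ | cos x = 0} ⊆ Set.range fun n : ℤ => (2 * n + 1) * π / 2 := by
    intro x hx
    obtain ⟨n, hn⟩ := cos_eq_zero_iff.1 hx
    exact ⟨n, hn.symm⟩
  rw [ae_iff]
  simpa using ((Set.countable_range _).mono h).measure_zero volume

lemma abs_log_le {t M : ℝ} (ht0 : 0 ≤ t) (htM : t ≤ M) (hM : 1 ≤ M) :
    |log t| ≤ 2 * log M - log t := by
  have hM0 := log_nonneg hM
  rcases le_total (log t) 0 with h | h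
  · rw [abs_of_nonpos h]; linarith
  · rw [abs_of_nonneg h]
    rcases ht0.eq_or_lt with rfl | ht
    · simpa using hM0
    · linarith [log_le_log ht htM]

lemma intervalIntegrable_log_abs_add_mul_cos (k b u v : ℝ) :
    IntervalIntegrable (fun x => log |k + b * cos x|) volume u v := by
  have h : AnalyticOnNhd ℝ (fun x => k + b * cos x) (Set.uIcc u v) := by
    intro x _
    exact analyticAt_const.add (analyticAt_const.mul (analyticOnNhd_cos x ‹_›))
  simpa [Function.comp_def] using h.meromorphicOn.intervalIntegrable_log

lemma integral_log_abs_add_mul_cos_mul_cos (k : ℝ) {x : ℝ} (hx : cos x ≠ 0) :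
    ∫ y in 0..2 * π, log |k + 4 * cos x * cos y| =
      2 * π * (log 2 + log (cos x) + arcoshRatio (|k| / 4) |cos x|) := by
  rw [integral_log_abs_add_mul_cos k (b := 4 * cos x) (by simpa using hx), abs_mul,
    abs_of_pos (by norm_num : (0 : ℝ) < 4), show |k| = 4 * (|k| / 4) by ring,
    arcoshRatio_mul (by norm_num), show 4 * |cos x| / 2 = 2 * |cos x| by ring,
    log_mul (by norm_num) (by simpa using hx), log_abs]
  ring_nf

lemma integrable_log_abs_add_mul_cos_mul_cos (k : ℝ) :
    Integrable (fun p : ℝ × ℝ => log |k + 4 * cos p.1 * cos p.2|)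
      ((volume.restrict (Set.Ioc 0 (2 * π))).prod (volume.restrict (Set.Ioc 0 (2 * π)))) := by
  have h2pi : (0 : ℝ) ≤ 2 * π := by positivity
  have hmeas : Measurable (fun p : ℝ × ℝ => log |k + 4 * cos p.1 * cos p.2|) := by fun_prop
  have hsec (x : ℝ) := (intervalIntegrable_iff_integrableOn_Ioc_of_le h2pi).1
    (intervalIntegrable_log_abs_add_mul_cos k (4 * cos x) 0 (2 * π))
  rw [integrable_prod_iff hmeas.aestronglyMeasurable]
  refine ⟨.of_forall hsec, ?_⟩
  set M := |k| + 4 with hM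
  have hdom : Integrable (fun x => 2 * π * (2 * log M - (log 2 + log (cos x))))
      (volume.restrict (Set.Ioc 0 (2 * π))) := by
    have h : IntegrableOn (fun x => log (cos x)) (Set.Ioc 0 (2 * π)) :=
      (intervalIntegrable_iff_integrableOn_Ioc_of_le h2pi).1 intervalIntegrable_log_cos
    exact ((integrable_const _).sub ((integrable_const _).add h)).const_mul _
  refine hdom.mono' hmeas.aestronglyMeasurable.norm.integral_prod_right' ?_
  filter_upwards [ae_restrict_of_ae ae_cos_ne_zero] with x hx
  have hx' := integral_log_abs_add_mul_cos_mul_cos k hx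
  rw [intervalIntegral.integral_of_le h2pi] at hx'
  have hle (y : ℝ) : ‖log |k + 4 * cos x * cos y|‖ ≤ 2 * log M - log |k + 4 * cos x * cos y| := by
    refine abs_log_le (abs_nonneg _) ((abs_add_le _ _).trans ?_) (by
      rw [hM]; linarith [abs_nonneg k])
    have : |cos x| * |cos y| ≤ 1 :=
      mul_le_one₀ (abs_cos_le_one x) (abs_nonneg _) (abs_cos_le_one y)
    rw [abs_mul, abs_mul, abs_of_pos (by norm_num : (0 : ℝ) < 4)]
    linarith
  rw [norm_of_nonneg (integral_nonneg fun _ => norm_nonneg _)]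
  calc ∫ y in Set.Ioc 0 (2 * π), ‖log |k + 4 * cos x * cos y|‖
      ≤ ∫ y in Set.Ioc 0 (2 * π), (2 * log M - log |k + 4 * cos x * cos y|) :=
        integral_mono (hsec x).norm ((integrable_const _).sub (hsec x)) hle
    _ = 2 * π * (2 * log M) - 2 * π * (log 2 + log (cos x) + arcoshRatio (|k| / 4) |cos x|) := by
        rw [integral_sub (integrable_const _) (hsec x), hx']
        simp [pi_nonneg]
    _ ≤ 2 * π * (2 * log M - (log 2 + log (cos x))) := by
        have := mul_nonneg h2pi (arcoshRatio_nonneg (c := |k| / 4) (abs_pos.2 hx))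
        linarith

lemma integral_log_abs_eq_integral_arcoshRatio (k : ℝ) :
    ∫ θ : Fin 2 → ℝ in Set.univ.pi fun _ => Set.Icc 0 (2 * π),
      log |k + 4 * cos (θ 0) * cos (θ 1)| =
    8 * π * ∫ x in 0..π / 2, arcoshRatio (|k| / 4) (cos x) := by
  have h2pi : (0 : ℝ) ≤ 2 * π := by positivity
  have hF := integrable_log_abs_add_mul_cos_mul_cos k
  have hpre : (Set.univ.pi fun _ => Set.Icc 0 (2 * π)) =
      MeasurableEquiv.finTwoArrow ⁻¹' (Set.Icc (0 : ℝ) (2 * π) ×ˢ Set.Icc (0 : ℝ) (2 * π)) := by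
    ext θ
    simp only [MeasurableEquiv.finTwoArrow, Set.mem_pi, Set.mem_univ, true_imp_iff,
      Fin.forall_fin_two, Set.mem_preimage, Set.mem_prod]
    rfl
  have hinner : ∀ᵐ x ∂volume.restrict (Set.Ioc 0 (2 * π)),
      ∫ y in Set.Ioc 0 (2 * π), log |k + 4 * cos x * cos y| =
      2 * π * (log 2 + log (cos x) + arcoshRatio (|k| / 4) |cos x|) := by
    filter_upwards [ae_restrict_of_ae ae_cos_ne_zero] with x hx
    rw [← intervalIntegral.integral_of_le h2pi, integral_log_abs_add_mul_cos_mul_cos k hx]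
  have hlog : IntegrableOn (fun x => log 2 + log (cos x)) (Set.Ioc 0 (2 * π)) :=
    (integrable_const _).add
      ((intervalIntegrable_iff_integrableOn_Ioc_of_le h2pi).1 intervalIntegrable_log_cos)
  have hR : IntegrableOn (fun x => arcoshRatio (|k| / 4) |cos x|) (Set.Ioc 0 (2 * π)) := by
    refine (((hF.integral_prod_left.congr hinner).const_mul (2 * π)⁻¹).sub hlog).congr
      (.of_forall fun x => ?_)
    simp only [Pi.sub_apply]
    field_simp
    ring
  calc _ = ∫ p in Set.Icc (0 : ℝ) (2 * π) ×ˢ Set.Icc (0 : ℝ) (2 * π),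
          log |k + 4 * cos p.1 * cos p.2| := by
        rw [hpre, ← (volume_preserving_finTwoArrow ℝ).setIntegral_preimage_emb
          (MeasurableEquiv.measurableEmbedding _)]
        rfl
    _ = ∫ x in Set.Ioc 0 (2 * π), ∫ y in Set.Ioc 0 (2 * π), log |k + 4 * cos x * cos y| := by
        rw [Measure.volume_eq_prod, ← Measure.prod_restrict, ← restrict_Ioc_eq_restrict_Icc,
          integral_prod _ hF]
    _ = 2 * π * ∫ x in 0..2 * π, arcoshRatio (|k| / 4) |cos x| := by
        rw [integral_congr_ae hinner, integral_const_mul, integral_add hlog hR,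
          ← intervalIntegral.integral_of_le h2pi, ← intervalIntegral.integral_of_le h2pi,
          intervalIntegral.integral_add (g := fun x => log (cos x)) intervalIntegrable_const
            intervalIntegrable_log_cos, integral_log_cos_zero_two_pi]
        simp
    _ = _ := by
        rw [integral_comp_abs_cos ((intervalIntegrable_iff_integrableOn_Ioc_of_le h2pi).2 hR)]
        ring

/-- For `|k| < 4`, the logarithmic Mahler measure of `k + (x+x⁻¹)(y+y⁻¹)`:
`(2π)⁻² ∫ log|k + 4 cos θ₁ cos θ₂| = (|k|/4) · ₃F₂(1/2,1/2,1/2; 1, 3/2; k²/16)`. -/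
theorem stmt9 (k : ℝ) (hk : |k| < 4) :
    ((2 * π) ^ 2)⁻¹ *
        (∫ θ : Fin 2 → ℝ in Set.univ.pi fun _ => Set.Icc 0 (2 * π),
          Real.log |k + 4 * Real.cos (θ 0) * Real.cos (θ 1)|) =
      |k| / 4 *
        ∑' n : ℕ, pochR (1/2) n * pochR (1/2) n * pochR (1/2) n /
          (pochR 1 n * pochR (3/2) n * (n.factorial : ℝ)) * (k ^ 2 / 16) ^ n := by
  rw [integral_log_abs_eq_integral_arcoshRatio]
  rcases eq_or_ne k 0 with rfl | hk0
  · have : ∫ x in 0..π / 2, arcoshRatio 0 (cos x) = 0 := by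
      rw [intervalIntegral.integral_congr (g := fun _ => 0), intervalIntegral.integral_zero]
      intro x hx
      rw [Set.uIcc_of_le (by positivity)] at hx
      have := cos_nonneg_of_mem_Icc ⟨by linarith [hx.1, pi_pos], hx.2⟩
      simp [arcoshRatio, this.not_gt]
    simp [this]
  · have hc0 : 0 < |k| / 4 := by positivity
    have hc1 : |k| / 4 < 1 := by linarith
    rw [integral_arcoshRatio_cos hc0 hc1, ← (hasSum_integral_logSecAddTan hc0 hc1).tsum_eq]
    simp_rw [mul_div_assoc (π / 2), mul_assoc (π / 2), tsum_mul_left, div_pow, sq_abs]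
    have hterm (n : ℕ) : pochR (1/2) n * pochR (1/2) n * pochR (1/2) n /
        (pochR 1 n * pochR (3/2) n * (n.factorial : ℝ)) =
        pochR (1 / 2) n ^ 2 / n.factorial ^ 2 / (2 * n + 1) := by
      have := (pochR_half_pos n).ne'
      rw [pochR_one, pochR_three_halves]
      field_simp
    simp_rw [hterm]
    norm_num
    field_simp
    norm_num
end
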